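/- arXiv:1806.08161 — 13 statements merged into one kernel-verified Lean document; each statement's English description precedes it below -/
import Mathlib

section
/- Let γ > 0, set β = γ²/2, let h : [0,∞) → ℝ be continuous, let g_prev : [0,∞) → ℝ be continuously differentiable, define k(x) = γ·g_prev(x) − g_prev'(x), and let c ∈ ℝ. Define g(x) = 2·∫₀^x e^{2γy} (∫₀^y h(z)·k(z)·e^{−2γz} dz) dy + c·(e^{2γx} − 1)/γ, and set f(x) = e^{−γx}·g(x) and f_prev(x) = e^{−γx}·g_prev(x). Then f is twice continuously differentiable on (0,∞), satisfies (1/2)·f''(x) = β·f(x) − h(x)·f_prev'(x) for all x > 0, and f(0) = 0. -/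
open Real Filter intervalIntegral

/-- The recursive step for solving the o(εⁱ) boundary value problem
(1/2)f'' = β·f − h·f_prev' with f(0) = 0: with γ > 0, β = γ²/2, h continuous on [0,∞),
g_prev C¹ on [0,∞), k = γ·g_prev − g_prev', c ∈ ℝ,
g(x) = 2·∫₀^x e^{2γy} (∫₀^y h(z)·k(z)·e^{−2γz} dz) dy + c·(e^{2γx} − 1)/γ,
f = e^{−γx}·g, f_prev = e^{−γx}·g_prev, the function f is C² on (0,∞),
satisfies the ODE on (0,∞) and f(0) = 0. -/
theorem stmt_1 (γ β : ℝ) (hγ : 0 < γ) (hβ : β = γ ^ 2 / 2)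
    (h g_prev : ℝ → ℝ)
    (hh : ContinuousOn h (Set.Ici 0))
    (hgprev : ContDiffOn ℝ 1 g_prev (Set.Ici 0))
    (k : ℝ → ℝ) (hk : ∀ x : ℝ, k x = γ * g_prev x - deriv g_prev x)
    (c : ℝ)
    (g : ℝ → ℝ)
    (hg : ∀ x : ℝ, g x =
      2 * (∫ y in (0:ℝ)..x, Real.exp (2 * γ * y) *
            (∫ z in (0:ℝ)..y, h z * k z * Real.exp (-(2 * γ * z)))) +
        c * (Real.exp (2 * γ * x) - 1) / γ)
    (f f_prev : ℝ → ℝ)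
    (hf : ∀ x : ℝ, f x = Real.exp (-(γ * x)) * g x)
    (hfprev : ∀ x : ℝ, f_prev x = Real.exp (-(γ * x)) * g_prev x) :
    ContDiffOn ℝ 2 f (Set.Ioi 0) ∧
    (∀ x : ℝ, 0 < x →
      (1 / 2) * deriv (deriv f) x = β * f x - h x * deriv f_prev x) ∧
    f 0 = 0 := by
  have hdg : ContinuousOn (derivWithin g_prev (Set.Ici 0)) (Set.Ici 0) :=
    hgprev.continuousOn_derivWithin (uniqueDiffOn_Ici 0) le_rfl
  have hdgeq : ∀ x : ℝ, 0 < x → derivWithin g_prev (Set.Ici 0) x = deriv g_prev x := fun x hx =>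
    derivWithin_of_mem_nhds (Ici_mem_nhds hx)
  have hmax : ∀ u : ℝ → ℝ, ContinuousOn u (Set.Ici 0) → Continuous (fun z => u (max z 0)) := by
    intro u hu
    exact hu.comp_continuous (by fun_prop) (fun x => le_max_right x 0)
  obtain ⟨P, hP, hPeq⟩ : ∃ P : ℝ → ℝ, Continuous P ∧ ∀ x, 0 < x → P x = h x * k x := by
    refine ⟨fun z => h (max z 0) * (γ * g_prev (max z 0) -
      derivWithin g_prev (Set.Ici 0) (max z 0)), ?_, ?_⟩
    · exact (hmax h hh).mul ((continuous_const.mul (hmax _ hgprev.continuousOn)).sub (hmax _ hdg))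
    · intro x hx
      simp only [max_eq_left hx.le, hdgeq x hx, hk]
  have hQ : Continuous (fun z => P z * Real.exp (-(2 * γ * z))) := by fun_prop
  obtain ⟨J, hJdef⟩ : ∃ J : ℝ → ℝ, J = fun y => ∫ z in (0:ℝ)..y, P z * Real.exp (-(2 * γ * z)) :=
    ⟨_, rfl⟩
  have hJ : ∀ x, HasDerivAt J (P x * Real.exp (-(2 * γ * x))) x := by
    intro x
    rw [hJdef]
    exact hQ.integral_hasStrictDerivAt 0 x |>.hasDerivAt
  have hJc : Continuous J := continuous_iff_continuousAt.2 fun x => (hJ x).continuousAt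
  have hEJ : Continuous (fun y => Real.exp (2 * γ * y) * J y) := by fun_prop
  obtain ⟨K, hKdef⟩ : ∃ K : ℝ → ℝ, K = fun x => ∫ y in (0:ℝ)..x, Real.exp (2 * γ * y) * J y :=
    ⟨_, rfl⟩
  have hK : ∀ x, HasDerivAt K (Real.exp (2 * γ * x) * J x) x := by
    intro x
    rw [hKdef]
    exact hEJ.integral_hasStrictDerivAt 0 x |>.hasDerivAt
  have hKc : Continuous K := continuous_iff_continuousAt.2 fun x => (hK x).continuousAt
  have hJeq : ∀ y, 0 ≤ y → (∫ z in (0:ℝ)..y, h z * k z * Real.exp (-(2 * γ * z))) = J y := by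
    intro y hy
    rw [hJdef]
    apply intervalIntegral.integral_congr_ae
    refine Eventually.of_forall fun z hz => ?_
    rw [Set.uIoc_of_le hy] at hz
    rw [hPeq z hz.1]
  have hgeq : ∀ x, 0 ≤ x → g x = 2 * K x + c * (Real.exp (2 * γ * x) - 1) / γ := by
    intro x hx
    rw [hg, hKdef]
    congr 2
    apply intervalIntegral.integral_congr
    intro y hy
    rw [Set.uIcc_of_le hx] at hy
    simp only [hJeq y hy.1]
  have he : ∀ a x : ℝ, HasDerivAt (fun x => Real.exp (a * x)) (a * Real.exp (a * x)) x := by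
    intro a x
    have := ((hasDerivAt_id x).const_mul a).exp
    simpa [mul_comm] using this
  -- the global extension
  obtain ⟨F, hF⟩ : ∃ F : ℝ → ℝ, F = fun x => Real.exp (-γ * x) *
      (2 * K x + c * (Real.exp (2 * γ * x) - 1) / γ) := ⟨_, rfl⟩
  obtain ⟨F1, hF1⟩ : ∃ F1 : ℝ → ℝ, F1 = fun x => -γ * F x +
      Real.exp (-γ * x) * (Real.exp (2 * γ * x) * (2 * J x + 2 * c)) := ⟨_, rfl⟩
  have hexp : ∀ x : ℝ, Real.exp (2 * γ * x) * Real.exp (-(2 * γ * x)) = 1 := by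
    intro x
    rw [← Real.exp_add]; simp
  have hFd : ∀ x, HasDerivAt F (F1 x) x := by
    intro x
    have := (he (-γ) x).mul (((hK x).const_mul 2).add
      ((((he (2 * γ) x).sub_const 1).const_mul c).div_const γ))
    rw [hF1, hF]
    refine HasDerivAt.congr_deriv (f := _) this ?_
    simp only [Pi.add_apply]
    field_simp
  have hF1d : ∀ x, HasDerivAt F1 (γ ^ 2 * F x + 2 * Real.exp (-γ * x) * P x) x := by
    intro x
    have := ((hFd x).const_mul (-γ)).add ((he (-γ) x).mul ((he (2 * γ) x).mul
      (((hJ x).const_mul 2).add_const (2 * c))))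
    have e1 := hexp x
    rw [hF1]
    refine HasDerivAt.congr_deriv (f := _) this ?_
    rw [hF1]
    simp only [Pi.mul_apply]
    linear_combination (2 * Real.exp (-γ * x) * P x) * e1
  have hFc : Continuous F := continuous_iff_continuousAt.2 fun x => (hFd x).continuousAt
  have hdF : deriv F = F1 := funext fun x => (hFd x).deriv
  have hdF1 : deriv F1 = fun x => γ ^ 2 * F x + 2 * Real.exp (-γ * x) * P x :=
    funext fun x => (hF1d x).deriv
  have hF1C : ContDiff ℝ 1 F1 := by
    rw [contDiff_one_iff_deriv]
    refine ⟨fun x => (hF1d x).differentiableAt, ?_⟩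
    rw [hdF1]
    fun_prop
  have hFC : ContDiff ℝ 2 F := by
    have : ContDiff ℝ (1 + 1) F := by
      rw [contDiff_succ_iff_deriv]
      refine ⟨fun x => (hFd x).differentiableAt, by simp, ?_⟩
      rwa [hdF]
    simpa [one_add_one_eq_two] using this
  have hfF : ∀ x, 0 ≤ x → f x = F x := by
    intro x hx
    rw [hf, hgeq x hx, hF]; simp only [neg_mul]
  have hev : ∀ x, 0 < x → f =ᶠ[nhds x] F := fun x hx =>
    Filter.mem_of_superset (Ioi_mem_nhds hx) fun y hy => hfF y (le_of_lt hy)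
  refine ⟨hFC.contDiffOn.congr fun x hx => hfF x (le_of_lt hx), ?_, ?_⟩
  · intro x hx
    rw [(hev x hx).deriv.deriv_eq, hdF, hdF1, hfF x hx.le]
    have hd : HasDerivAt g_prev (deriv g_prev x) x :=
      ((hgprev.differentiableOn (by simp)).differentiableAt (Ici_mem_nhds hx)).hasDerivAt
    have hfp : f_prev = fun x => Real.exp (-γ * x) * g_prev x := by
      funext y
      rw [hfprev, neg_mul]
    have h2 : deriv f_prev x = -γ * Real.exp (-γ * x) * g_prev x + Real.exp (-γ * x) * deriv g_prev x := by
      rw [hfp]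
      exact ((he (-γ) x).mul hd).deriv
    rw [h2]
    simp only [hPeq x hx, hk, hβ]
    ring
  · rw [hf, hg]
    simp
end

section
/- Let β > 0, γ = √(2β), and θ ∈ ℝ. Define f₁(x) = e^{−γx}·(x²/2 + (1 − 2θγ)·x/(2γ)). Then f₁ satisfies (1/2)·f₁''(x) = β·f₁(x) − (θ − x)·(d/dx)(e^{−γx}) for all x > 0, and moreover f₁(0) = 0 and f₁(x) → 0 as x → ∞. -/
open Real Filter

/-- For the OU process with drift h(x) = θ − x, the first-order perturbation term
f₁(x) = e^{−γx}·(x²/2 + (1 − 2θγ)·x/(2γ)) with γ = √(2β) solves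
(1/2)·f₁'' = β·f₁ − (θ − x)·(e^{−γx})' on (0,∞), with f₁(0) = 0 and f₁(x) → 0 as x → ∞. -/
theorem stmt_2 (β : ℝ) (hβ : 0 < β) (γ : ℝ) (hγ : γ = Real.sqrt (2 * β)) (θ : ℝ)
    (f₁ : ℝ → ℝ)
    (hf₁ : ∀ x : ℝ, f₁ x =
      Real.exp (-(γ * x)) * (x ^ 2 / 2 + (1 - 2 * θ * γ) * x / (2 * γ))) :
    (∀ x : ℝ, 0 < x →
      (1 / 2) * deriv (deriv f₁) x =
        β * f₁ x - (θ - x) * deriv (fun y : ℝ => Real.exp (-(γ * y))) x) ∧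
    f₁ 0 = 0 ∧
    Tendsto f₁ atTop (nhds 0) := by
  have hg : 0 < γ := by rw [hγ]; positivity
  have hg2 : β = γ ^ 2 / 2 := by
    rw [hγ, Real.sq_sqrt (by positivity)]; ring
  obtain ⟨c, hc⟩ : ∃ c, c = (1 - 2 * θ * γ) / (2 * γ) := ⟨_, rfl⟩
  have hcg : c * γ = (1 - 2 * θ * γ) / 2 := by rw [hc]; field_simp
  have hf : f₁ = fun x => Real.exp (-(γ * x)) * (x ^ 2 / 2 + c * x) := by
    funext x; rw [hf₁, hc]; ring
  have he : ∀ x : ℝ, HasDerivAt (fun y : ℝ => Real.exp (-(γ * y)))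
      (Real.exp (-(γ * x)) * (-γ)) x := by
    intro x
    have h := ((hasDerivAt_id x).const_mul γ).neg.exp
    simpa using h
  have hp : ∀ x : ℝ, HasDerivAt (fun y : ℝ => y ^ 2 / 2 + c * y) (x + c) x := by
    intro x
    have h := (((hasDerivAt_id x).pow 2).div_const 2).add ((hasDerivAt_id x).const_mul c)
    refine HasDerivAt.congr_deriv (f := fun y : ℝ => y ^ 2 / 2 + c * y) h ?_
    simp
  have hd : deriv f₁ = fun x => Real.exp (-(γ * x)) * (-γ) * (x ^ 2 / 2 + c * x)
      + Real.exp (-(γ * x)) * (x + c) := by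
    funext x
    rw [hf]
    exact ((he x).mul (hp x)).deriv
  refine ⟨?_, ?_, ?_⟩
  · intro x _
    have h2 := ((((he x).mul_const (-γ)).mul (hp x)).add
      ((he x).mul ((hasDerivAt_id x).add_const c))).deriv
    have h3 := (congrArg (fun g => deriv g x) hd).trans h2
    simp only [id] at h3
    rw [h3, (he x).deriv, hf, hg2]
    linear_combination (-Real.exp (-(γ * x))) * hcg
  · rw [hf₁]; simp
  · have hl : Tendsto (fun x : ℝ => γ * x) atTop atTop := tendsto_id.const_mul_atTop hg
    have h1 := (Real.tendsto_pow_mul_exp_neg_atTop_nhds_zero 1).comp hl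
    have h2 := (Real.tendsto_pow_mul_exp_neg_atTop_nhds_zero 2).comp hl
    have h := (h2.const_mul (1 / (2 * γ ^ 2))).add (h1.const_mul (c / γ))
    rw [hf]
    simp only [mul_zero, add_zero] at h
    refine h.congr fun x => ?_
    simp only [Function.comp]
    field_simp
end

section
/- Fix γ > 0, set β = γ²/2, and fix θ ∈ ℝ. For each i ≥ 1 let (p_j^{(i)})_{1 ≤ j ≤ 2i} be real numbers with p_2^{(1)} = 1/(2γ²) and p_1^{(1)} = (1 − 2θγ)/(2γ²), and suppose that for every i ≥ 2 the following recursion holds: p_{2i}^{(i)} = p_{2i−2}^{(i−1)}/(2i·γ²); p_{2i−1}^{(i)} = p_{2i−3}^{(i−1)}/((2i−1)·γ²) + (1/(2γ²) − (γθ + 2i−2)/((2i−1)·γ²))·p_{2i−2}^{(i−1)}; for every j with 2 < j < 2i−1: p_j^{(i)} = ((j+1)/2)·p_{j+1}^{(i)} + p_{j−2}^{(i−1)}/(γ²·j) − ((j−1+γθ)/(γ²·j))·p_{j−1}^{(i−1)} + (θ/γ)·p_j^{(i−1)}; p_2^{(i)} = (3/2)·p_3^{(i)} − ((1+γθ)/(2γ²))·p_1^{(i−1)}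 + (θ/γ)·p_2^{(i−1)}; and p_1^{(i)} = p_2^{(i)} + (θ/γ)·p_1^{(i−1)}. Define g_i(y) = Σ_{j=1}^{2i} p_j^{(i)}·y^j and f_i(x) = e^{−γx}·g_i(γx). Then for every i ≥ 2 and all x > 0, (1/2)·f_i''(x) = β·f_i(x) − (θ − x)·f_{i−1}'(x), and f_i(0) = 0 and f_i(x) → 0 as x → ∞. -/
open Real Filter

open Polynomial in
/-- polynomial with the coefficients `q 1, ..., q n` -/
noncomputable def auxPoly (q : ℕ → ℝ) (n : ℕ) : ℝ[X] :=
  ∑ j ∈ Finset.Icc 1 n, C (q j) * X ^ j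

lemma auxPoly_coeff (q : ℕ → ℝ) (n k : ℕ) :
    (auxPoly q n).coeff k = if 1 ≤ k ∧ k ≤ n then q k else 0 := by
  simp [auxPoly, Polynomial.coeff_X_pow]

lemma auxPoly_eval (q : ℕ → ℝ) (n : ℕ) (y : ℝ) :
    (auxPoly q n).eval y = ∑ j ∈ Finset.Icc 1 n, q j * y ^ j := by
  simp [auxPoly, Polynomial.eval_finsetSum]

lemma aux_deriv (γ : ℝ) (P : Polynomial ℝ) :
    deriv (fun x => Real.exp (-(γ * x)) * P.eval (γ * x)) =
      fun x => Real.exp (-(γ * x)) *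
        (Polynomial.C γ * (Polynomial.derivative P - P)).eval (γ * x) := by
  funext x
  have h0 : HasDerivAt (fun x : ℝ => γ * x) γ x := by
    simpa using (hasDerivAt_id x).const_mul γ
  have h1 := h0.neg.exp
  have h2 := (P.hasDerivAt (γ * x)).comp x h0
  have h3 := (h1.mul h2).deriv
  refine Eq.trans h3 ?_
  simp
  ring

/-- Recursive polynomial structure of the OU perturbation terms: with γ > 0, β = γ²/2,
θ ∈ ℝ, coefficients p_j^{(i)} satisfying the stated base case and recursion,
g_i(y) = Σ_{j=1}^{2i} p_j^{(i)} y^j and f_i(x) = e^{−γx} g_i(γx), for every i ≥ 2 the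
function f_i solves (1/2)f_i'' = β f_i − (θ−x) f_{i−1}' on (0,∞), with f_i(0) = 0 and
f_i(x) → 0 as x → ∞. -/
theorem stmt_3 (γ β θ : ℝ) (hγ : 0 < γ) (hβ : β = γ ^ 2 / 2)
    (p : ℕ → ℕ → ℝ)
    (hp12 : p 1 2 = 1 / (2 * γ ^ 2))
    (hp11 : p 1 1 = (1 - 2 * θ * γ) / (2 * γ ^ 2))
    (hrec : ∀ i : ℕ, 2 ≤ i →
      (p i (2 * i) = p (i - 1) (2 * i - 2) / (2 * (i : ℝ) * γ ^ 2)) ∧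
      (p i (2 * i - 1) =
        p (i - 1) (2 * i - 3) / ((2 * (i : ℝ) - 1) * γ ^ 2) +
          (1 / (2 * γ ^ 2) -
            (γ * θ + (2 * (i : ℝ) - 2)) / ((2 * (i : ℝ) - 1) * γ ^ 2)) *
            p (i - 1) (2 * i - 2)) ∧
      (∀ j : ℕ, 2 < j → j < 2 * i - 1 →
        p i j = ((j : ℝ) + 1) / 2 * p i (j + 1) +
          p (i - 1) (j - 2) / (γ ^ 2 * (j : ℝ)) -
          (((j : ℝ) - 1 + γ * θ) / (γ ^ 2 * (j : ℝ))) * p (i - 1) (j - 1) +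
          (θ / γ) * p (i - 1) j) ∧
      (p i 2 = 3 / 2 * p i 3 - ((1 + γ * θ) / (2 * γ ^ 2)) * p (i - 1) 1 +
        (θ / γ) * p (i - 1) 2) ∧
      (p i 1 = p i 2 + (θ / γ) * p (i - 1) 1))
    (g : ℕ → ℝ → ℝ)
    (hg : ∀ i : ℕ, ∀ y : ℝ, g i y = ∑ j ∈ Finset.Icc 1 (2 * i), p i j * y ^ j)
    (f : ℕ → ℝ → ℝ)
    (hf : ∀ i : ℕ, ∀ x : ℝ, f i x = Real.exp (-(γ * x)) * g i (γ * x)) :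
    ∀ i : ℕ, 2 ≤ i →
      (∀ x : ℝ, 0 < x →
        (1 / 2) * deriv (deriv (f i)) x = β * f i x - (θ - x) * deriv (f (i - 1)) x) ∧
      f i 0 = 0 ∧
      Tendsto (f i) atTop (nhds 0) := by
  intro i hi
  have hγ0 : γ ≠ 0 := hγ.ne'
  have hfP : ∀ i, f i = fun x => Real.exp (-(γ * x)) * (auxPoly (p i) (2 * i)).eval (γ * x) := by
    intro i
    funext x
    rw [hf, hg, auxPoly_eval]
  obtain ⟨m, rfl⟩ : ∃ m, i = m + 2 := ⟨i - 2, by omega⟩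
  obtain ⟨r1, r2, r3, r4, r5⟩ := hrec (m + 2) hi
  have e1 : m + 2 - 1 = m + 1 := by omega
  have e2 : 2 * (m + 2) - 2 = 2 * m + 2 := by omega
  have e3 : 2 * (m + 2) - 3 = 2 * m + 1 := by omega
  have e4 : 2 * (m + 2) - 1 = 2 * m + 3 := by omega
  have e5 : 2 * (m + 2) = 2 * m + 4 := by omega
  rw [e1] at r1 r2 r4 r5 ⊢
  simp only [e1] at r3
  rw [e2] at r1 r2
  rw [e3, e4] at r2
  rw [e4] at r3
  rw [e5] at r1
  push_cast at r1 r2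
  have key : Polynomial.C (γ ^ 2 / 2) *
        (Polynomial.derivative (Polynomial.derivative (auxPoly (p (m + 2)) (2 * (m + 2)))))
      - Polynomial.C (γ ^ 2) * Polynomial.derivative (auxPoly (p (m + 2)) (2 * (m + 2)))
      = (Polynomial.X - Polynomial.C (γ * θ)) *
        (Polynomial.derivative (auxPoly (p (m + 1)) (2 * (m + 1)))
          - auxPoly (p (m + 1)) (2 * (m + 1))) := by
    ext k
    have hm1 : (2 * (m : ℝ) + 3) ≠ 0 := by positivity
    have hm2 : (2 * (m : ℝ) + 4) ≠ 0 := by positivity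
    have hm3 : ((m : ℝ) + 2) ≠ 0 := by positivity
    rw [sub_mul]
    rcases k with _ | _ | k
    · simp only [Polynomial.coeff_sub, Polynomial.coeff_C_mul, Polynomial.coeff_derivative,
        auxPoly_coeff, Polynomial.coeff_X_mul_zero]
      rw [if_pos (by omega), if_pos (by omega), if_pos (by omega), if_neg (by omega)]
      norm_num
      rw [r5]
      field_simp
      ring
    · simp only [Polynomial.coeff_sub, Polynomial.coeff_C_mul, Polynomial.coeff_derivative,
        auxPoly_coeff, Polynomial.coeff_X_mul]
      rw [if_pos (by omega), if_pos (by omega), if_pos (by omega), if_neg (by omega), if_pos (by omega)]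
      norm_num
      rw [r4]
      field_simp
      ring
    · simp only [Polynomial.coeff_sub, Polynomial.coeff_C_mul, Polynomial.coeff_derivative,
        auxPoly_coeff, Polynomial.coeff_X_mul]
      have hk : ((k : ℝ) + 3) ≠ 0 := by positivity
      rcases lt_trichotomy k (2 * m) with h | h | h
      · rw [if_pos (by omega), if_pos (by omega), if_pos (by omega), if_pos (by omega),
          if_pos (by omega)]
        have := r3 (k + 3) (by omega) (by omega)
        simp only [show k + 3 - 2 = k + 1 by omega, show k + 3 - 1 = k + 2 by omega] at this
        push_cast at this ⊢
        norm_num [add_assoc] at this ⊢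
        rw [this]
        field_simp
        ring
      · subst h
        rw [if_pos (by omega), if_pos (by omega), if_pos (by omega), if_pos (by omega), if_neg (by omega)]
        push_cast
        norm_num [add_assoc]
        rw [r1, r2]
        rw [show 2 * ((m : ℝ) + 2) - 1 = 2 * m + 3 by ring]
        field_simp
        ring
      · rcases Nat.lt_or_ge k (2 * m + 2) with h' | h'
        · obtain rfl : k = 2 * m + 1 := by omega
          rw [if_neg (by omega), if_pos (by omega), if_neg (by omega), if_pos (by omega), if_neg (by omega)]
          push_cast
          norm_num [add_assoc]
          rw [r1]
          field_simp
          ring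
        · rw [if_neg (by omega), if_neg (by omega), if_neg (by omega), if_neg (by omega),
            if_neg (by omega)]
          simp
  refine ⟨?_, ?_, ?_⟩
  · intro x _
    have hk := congrArg (Polynomial.eval (γ * x)) key
    rw [hfP (m + 2), hfP (m + 1), aux_deriv, aux_deriv, aux_deriv]
    simp only [Polynomial.eval_sub, Polynomial.eval_mul, Polynomial.eval_C, Polynomial.eval_X,
      Polynomial.derivative_mul, Polynomial.derivative_C, Polynomial.derivative_sub,
      Polynomial.eval_add, Polynomial.eval_zero] at hk ⊢
    rw [hβ]
    linear_combination Real.exp (-(γ * x)) * hk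
  · rw [hf, hg]
    rw [Finset.sum_eq_zero]
    · simp
    · intro j hj
      have : j ≠ 0 := by have := (Finset.mem_Icc.mp hj).1; omega
      simp [this]
  · rw [hfP]
    have h := (Polynomial.tendsto_div_exp_atTop (auxPoly (p (m + 2)) (2 * (m + 2)))).comp
      (tendsto_id.const_mul_atTop hγ)
    refine h.congr fun x => ?_
    simp [Real.exp_neg, div_eq_mul_inv, mul_comm]
end

section
/- For each γ > 0 and θ ∈ ℝ define the family p_j^{(i)}(γ,θ) for i ≥ 1 and 1 ≤ j ≤ 2i by p_2^{(1)} = 1/(2γ²), p_1^{(1)} = (1 − 2θγ)/(2γ²), and for i ≥ 2 by the recursion: p_{2i}^{(i)} = p_{2i−2}^{(i−1)}/(2i·γ²); p_{2i−1}^{(i)} = p_{2i−3}^{(i−1)}/((2i−1)·γ²) + (1/(2γ²) − (γθ + 2i−2)/((2i−1)·γ²))·p_{2i−2}^{(i−1)}; for 2 < j < 2i−1: p_j^{(i)} = ((j+1)/2)·p_{j+1}^{(i)} + p_{j−2}^{(i−1)}/(γ²·j) − ((j−1+γθ)/(γ²·j))·p_{j−1}^{(i−1)} + (θ/γ)·p_j^{(i−1)};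 p_2^{(i)} = (3/2)·p_3^{(i)} − ((1+γθ)/(2γ²))·p_1^{(i−1)} + (θ/γ)·p_2^{(i−1)}; p_1^{(i)} = p_2^{(i)} + (θ/γ)·p_1^{(i−1)}. Then there exists a triply indexed real family c_k^{(i,j)}, for i ≥ 1, 1 ≤ j ≤ 2i and 0 ≤ k ≤ min(2i−j, i), not depending on γ or θ, such that for all γ > 0 and θ ∈ ℝ: p_j^{(i)}(γ,θ) = Σ_{k=0}^{min(2i−j,i)} c_k^{(i,j)} · γ^{−(2i−k)} · θ^k. -/
open Real Filter

/-- weight `i`, degree at most `m` in `γθ` -/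
def QQ (i m : ℕ) (f : ℝ → ℝ → ℝ) : Prop :=
  ∃ q : Polynomial ℝ, q.natDegree ≤ m ∧
    ∀ γ θ : ℝ, 0 < γ → f γ θ = (1 / γ) ^ (2 * i) * q.eval (γ * θ)

lemma QQ.mono {i m n : ℕ} {f : ℝ → ℝ → ℝ} (h : QQ i m f) (hmn : m ≤ n) : QQ i n f := by
  obtain ⟨q, hq, h⟩ := h
  exact ⟨q, hq.trans hmn, h⟩

lemma QQ.congr {i m : ℕ} {f g : ℝ → ℝ → ℝ} (h : QQ i m f)
    (hfg : ∀ γ θ : ℝ, 0 < γ → g γ θ = f γ θ) : QQ i m g := by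
  obtain ⟨q, hq, h⟩ := h
  exact ⟨q, hq, fun γ θ hγ => (hfg γ θ hγ).trans (h γ θ hγ)⟩

lemma QQ.add {i m : ℕ} {f g : ℝ → ℝ → ℝ} (hf : QQ i m f) (hg : QQ i m g) :
    QQ i m (fun γ θ => f γ θ + g γ θ) := by
  obtain ⟨q, hq, h⟩ := hf
  obtain ⟨r, hr, h'⟩ := hg
  refine ⟨q + r, Polynomial.natDegree_add_le_of_degree_le hq hr, fun γ θ hγ => ?_⟩
  simp only [h γ θ hγ, h' γ θ hγ, Polynomial.eval_add]; ring

lemma QQ.smul {i m : ℕ} {f : ℝ → ℝ → ℝ} (a : ℝ) (hf : QQ i m f) :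
    QQ i m (fun γ θ => a * f γ θ) := by
  obtain ⟨q, hq, h⟩ := hf
  refine ⟨Polynomial.C a * q, (Polynomial.natDegree_C_mul_le a q).trans hq, fun γ θ hγ => ?_⟩
  simp only [h γ θ hγ, Polynomial.eval_mul, Polynomial.eval_C]; ring

lemma QQ.lift {i m n : ℕ} {f : ℝ → ℝ → ℝ} (hf : QQ i m f) (hmn : m ≤ n) (a : ℝ) :
    QQ (i + 1) n (fun γ θ => a * (1 / γ ^ 2 * f γ θ)) := by
  apply QQ.smul
  obtain ⟨q, hq, h⟩ := hf
  refine ⟨q, hq.trans hmn, fun γ θ hγ => ?_⟩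
  simp only [h γ θ hγ]; ring

lemma QQ.liftT {i m n : ℕ} {f : ℝ → ℝ → ℝ} (hf : QQ i m f) (hmn : m + 1 ≤ n) (a : ℝ) :
    QQ (i + 1) n (fun γ θ => a * (θ / γ * f γ θ)) := by
  apply QQ.smul
  obtain ⟨q, hq, h⟩ := hf
  refine ⟨q * Polynomial.X, ?_, fun γ θ hγ => ?_⟩
  · refine Polynomial.natDegree_mul_le.trans (le_trans ?_ hmn)
    have := Polynomial.natDegree_X_le (R := ℝ)
    omega
  · simp only [h γ θ hγ, Polynomial.eval_mul, Polynomial.eval_X]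
    have : γ ≠ 0 := hγ.ne'
    rw [show 2 * (i + 1) = 2 * i + 2 by ring, pow_add]
    field_simp

lemma QQ.sum {i m : ℕ} {f : ℝ → ℝ → ℝ} (hf : QQ i m f) (hm : m ≤ i) :
    ∃ c : ℕ → ℝ, ∀ γ θ : ℝ, 0 < γ → f γ θ =
      ∑ k ∈ Finset.range (m + 1), c k * (1 / γ) ^ (2 * i - k) * θ ^ k := by
  obtain ⟨q, hq, h⟩ := hf
  refine ⟨q.coeff, fun γ θ hγ => ?_⟩
  rw [h γ θ hγ, Polynomial.eval_eq_sum_range' (Nat.lt_succ_of_le hq), Finset.mul_sum]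
  refine Finset.sum_congr rfl fun k hk => ?_
  have hk' : k < m + 1 := Finset.mem_range.1 hk
  obtain ⟨d, hd⟩ : ∃ d, 2 * i = d + k := ⟨2 * i - k, by omega⟩
  have : γ ≠ 0 := hγ.ne'
  rw [hd, Nat.add_sub_cancel, pow_add, mul_pow, one_div, inv_pow, inv_pow]
  field_simp

/-- Recursive polynomial decomposition: for the family p_j^{(i)}(γ,θ) defined by the
stated base case and recursion, there exists a triply indexed real family c_k^{(i,j)}
(not depending on γ or θ) such that for all γ > 0 and θ ∈ ℝ,
p_j^{(i)}(γ,θ) = Σ_{k=0}^{min(2i−j,i)} c_k^{(i,j)} γ^{−(2i−k)} θ^k. -/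
theorem stmt_4 (p : ℝ → ℝ → ℕ → ℕ → ℝ)
    (hbase : ∀ γ θ : ℝ, 0 < γ →
      p γ θ 1 2 = 1 / (2 * γ ^ 2) ∧ p γ θ 1 1 = (1 - 2 * θ * γ) / (2 * γ ^ 2))
    (hrec : ∀ γ θ : ℝ, 0 < γ → ∀ i : ℕ, 2 ≤ i →
      (p γ θ i (2 * i) = p γ θ (i - 1) (2 * i - 2) / (2 * (i : ℝ) * γ ^ 2)) ∧
      (p γ θ i (2 * i - 1) =
        p γ θ (i - 1) (2 * i - 3) / ((2 * (i : ℝ) - 1) * γ ^ 2) +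
          (1 / (2 * γ ^ 2) -
            (γ * θ + (2 * (i : ℝ) - 2)) / ((2 * (i : ℝ) - 1) * γ ^ 2)) *
            p γ θ (i - 1) (2 * i - 2)) ∧
      (∀ j : ℕ, 2 < j → j < 2 * i - 1 →
        p γ θ i j = ((j : ℝ) + 1) / 2 * p γ θ i (j + 1) +
          p γ θ (i - 1) (j - 2) / (γ ^ 2 * (j : ℝ)) -
          (((j : ℝ) - 1 + γ * θ) / (γ ^ 2 * (j : ℝ))) * p γ θ (i - 1) (j - 1) +
          (θ / γ) * p γ θ (i - 1) j) ∧
      (p γ θ i 2 = 3 / 2 * p γ θ i 3 - ((1 + γ * θ) / (2 * γ ^ 2)) * p γ θ (i - 1) 1 +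
        (θ / γ) * p γ θ (i - 1) 2) ∧
      (p γ θ i 1 = p γ θ i 2 + (θ / γ) * p γ θ (i - 1) 1)) :
    ∃ c : ℕ → ℕ → ℕ → ℝ,
      ∀ γ θ : ℝ, 0 < γ → ∀ i : ℕ, 1 ≤ i → ∀ j : ℕ, 1 ≤ j → j ≤ 2 * i →
        p γ θ i j =
          ∑ k ∈ Finset.range (min (2 * i - j) i + 1),
            c i j k * (1 / γ) ^ (2 * i - k) * θ ^ k := by
  have key : ∀ i : ℕ, ∀ j : ℕ, 1 ≤ j → j ≤ 2 * (i + 1) →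
      QQ (i + 1) (min (2 * (i + 1) - j) (i + 1)) (fun γ θ => p γ θ (i + 1) j) := by
    intro i
    induction i with
    | zero =>
      intro j h1 h2
      obtain rfl | rfl : j = 1 ∨ j = 2 := by omega
      · refine ⟨Polynomial.C (1 / 2) - Polynomial.X, ?_, fun γ θ hγ => ?_⟩
        · refine (Polynomial.natDegree_sub_le _ _).trans ?_
          simp
        · have : γ ≠ 0 := hγ.ne'
          simp only [zero_add, (hbase γ θ hγ).2, Polynomial.eval_sub, Polynomial.eval_C,
            Polynomial.eval_X, mul_one, one_div, inv_pow]
          field_simp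
      · refine ⟨Polynomial.C (1 / 2), by simp, fun γ θ hγ => ?_⟩
        have : γ ≠ 0 := hγ.ne'
        simp only [zero_add, (hbase γ θ hγ).1, Polynomial.eval_C, mul_one, one_div, inv_pow]
        field_simp
    | succ n ih =>
      have R := fun γ θ hγ => hrec γ θ hγ (n + 1 + 1) (by omega)
      simp only [Nat.add_sub_cancel] at R
      have top : QQ (n + 1 + 1) (min (2 * (n + 1 + 1) - 2 * (n + 1 + 1)) (n + 1 + 1))
          (fun γ θ => p γ θ (n + 1 + 1) (2 * (n + 1 + 1))) := by
        have e := ih (2 * (n + 1 + 1) - 2) (by omega) (by omega)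
        refine (e.lift (by omega) (1 / (2 * ((n + 1 + 1 : ℕ) : ℝ)))).congr fun γ θ hγ => ?_
        simp only [(R γ θ hγ).1]
        have : γ ≠ 0 := hγ.ne'
        field_simp
      have top1 : QQ (n + 1 + 1) (min (2 * (n + 1 + 1) - (2 * (n + 1 + 1) - 1)) (n + 1 + 1))
          (fun γ θ => p γ θ (n + 1 + 1) (2 * (n + 1 + 1) - 1)) := by
        have e := ih (2 * (n + 1 + 1) - 2) (by omega) (by omega)
        have e' := ih (2 * (n + 1 + 1) - 3) (by omega) (by omega)
        have hN : (2 * ((n + 1 + 1 : ℕ) : ℝ) - 1) ≠ 0 := by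
          push_cast
          have : (0 : ℝ) ≤ n := Nat.cast_nonneg n
          intro h
          linarith
        refine (((e'.lift (by omega) (1 / (2 * ((n + 1 + 1 : ℕ) : ℝ) - 1))).add
          (e.lift (by omega) (1 / 2 - (2 * ((n + 1 + 1 : ℕ) : ℝ) - 2) /
            (2 * ((n + 1 + 1 : ℕ) : ℝ) - 1)))).add
          (e.liftT (by omega) (-1 / (2 * ((n + 1 + 1 : ℕ) : ℝ) - 1)))).congr fun γ θ hγ => ?_
        simp only [(R γ θ hγ).2.1]
        generalize (2 * ((n + 1 + 1 : ℕ) : ℝ) - 1) = N at *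
        have : γ ≠ 0 := hγ.ne'
        field_simp
        ring
      -- descending induction down to `j = 3`
      have mid : ∀ d j : ℕ, j + d = 2 * (n + 1 + 1) - 1 → 2 < j →
          QQ (n + 1 + 1) (min (2 * (n + 1 + 1) - j) (n + 1 + 1))
          (fun γ θ => p γ θ (n + 1 + 1) j) := by
        intro d
        induction d with
        | zero =>
          intro j hj _
          obtain rfl : j = 2 * (n + 1 + 1) - 1 := by omega
          exact top1
        | succ d ihd =>
          intro j hj hj2
          have a := ihd (j + 1) (by omega) (by omega)
          have e0 := ih (j - 2) (by omega) (by omega)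
          have e1 := ih (j - 1) (by omega) (by omega)
          have e2 := ih j (by omega) (by omega)
          have hj0 : (j : ℝ) ≠ 0 := by
            have : j ≠ 0 := by omega
            exact_mod_cast this
          refine (((((a.mono (by omega)).smul (((j : ℝ) + 1) / 2)).add
            (e0.lift (by omega) (1 / (j : ℝ)))).add
            (e1.lift (by omega) (-((j : ℝ) - 1) / j))).add
            ((e1.liftT (by omega) (-1 / (j : ℝ))).add (e2.liftT (by omega) 1))).congr
            fun γ θ hγ => ?_
          simp only [(R γ θ hγ).2.2.1 j hj2 (by omega)]
          have : γ ≠ 0 := hγ.ne'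
          field_simp
          ring
      have two : QQ (n + 1 + 1) (min (2 * (n + 1 + 1) - 2) (n + 1 + 1))
          (fun γ θ => p γ θ (n + 1 + 1) 2) := by
        have a := mid (2 * (n + 1 + 1) - 1 - 3) 3 (by omega) (by omega)
        have e1 := ih 1 (by omega) (by omega)
        have e2 := ih 2 (by omega) (by omega)
        refine (((((a.mono (by omega)).smul (3 / 2)).add
            (e1.lift (by omega) (-1 / 2))).add
            (e1.liftT (by omega) (-1 / 2))).add (e2.liftT (by omega) 1)).congr
            fun γ θ hγ => ?_
        simp only [(R γ θ hγ).2.2.2.1]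
        have : γ ≠ 0 := hγ.ne'
        field_simp
        ring
      have one : QQ (n + 1 + 1) (min (2 * (n + 1 + 1) - 1) (n + 1 + 1))
          (fun γ θ => p γ θ (n + 1 + 1) 1) := by
        have e1 := ih 1 (by omega) (by omega)
        refine ((two.mono (by omega)).add (e1.liftT (by omega) 1)).congr fun γ θ hγ => ?_
        simp only [(R γ θ hγ).2.2.2.2]
        ring
      intro j h1 h2
      by_cases c1 : j = 1
      · subst c1; exact one
      by_cases c2 : j = 2
      · subst c2; exact two
      by_cases c3 : j = 2 * (n + 1 + 1)
      · subst c3; exact top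
      exact mid (2 * (n + 1 + 1) - 1 - j) j (by omega) (by omega)
  have key2 : ∀ i j : ℕ, ∃ c : ℕ → ℝ, 1 ≤ i → 1 ≤ j → j ≤ 2 * i → ∀ γ θ : ℝ, 0 < γ →
      p γ θ i j = ∑ k ∈ Finset.range (min (2 * i - j) i + 1),
            c k * (1 / γ) ^ (2 * i - k) * θ ^ k := by
    intro i j
    by_cases h : 1 ≤ i ∧ 1 ≤ j ∧ j ≤ 2 * i
    · obtain ⟨hi, h1, h2⟩ := h
      obtain ⟨i, rfl⟩ : ∃ k, i = k + 1 := ⟨i - 1, by omega⟩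
      obtain ⟨c, hc⟩ := (key i j h1 h2).sum (by omega)
      exact ⟨c, fun _ _ _ => hc⟩
    · exact ⟨0, fun a b c => absurd ⟨a, b, c⟩ h⟩
  choose c hc using key2
  exact ⟨c, fun γ θ hγ i hi j h1 h2 => hc i j hi h1 h2 γ θ hγ⟩
end

section
/- For all real x > 0 and β > 0, ∫₀^∞ e^{−βt} · x·(2π)^{−1/2}·t^{−3/2}·e^{−x²/(2t)} dt = e^{−√(2β)·x}. -/
open Real Filter MeasureTheory

lemma aux_J (a b : ℝ) (ha : 0 < a) (hb : 0 < b) :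
    IntegrableOn (fun u : ℝ => (a + b / u ^ 2) * Real.exp (-(a * u - b / u) ^ 2)) (Set.Ioi 0) ∧
    ∫ u in Set.Ioi (0 : ℝ), (a + b / u ^ 2) * Real.exp (-(a * u - b / u) ^ 2) = √π := by
  have hd : ∀ u ∈ Set.Ioi (0 : ℝ),
      HasDerivWithinAt (fun u : ℝ => a * u - b / u) (a + b / u ^ 2) (Set.Ioi 0) u := by
    intro u hu
    have hu' : u ≠ 0 := ne_of_gt hu
    have h := ((hasDerivAt_id u).const_mul a).sub ((hasDerivAt_inv hu').const_mul b)
    refine HasDerivAt.hasDerivWithinAt ?_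
    have e : a + b / u ^ 2 = a * 1 - b * -(u ^ 2)⁻¹ := by
      rw [div_eq_mul_inv]; ring
    rw [e]
    exact h
  have hinj : Set.InjOn (fun u : ℝ => a * u - b / u) (Set.Ioi 0) := by
    intro u hu v hv h
    have hu0 : 0 < u := hu
    have hv0 : 0 < v := hv
    simp only at h
    field_simp at h
    have h2 : (u - v) * (a * (u * v) + b) = 0 := by linear_combination h
    have h3 : a * (u * v) + b ≠ 0 := by positivity
    have := (mul_eq_zero.mp h2).resolve_right h3
    linarith
  have himg : (fun u : ℝ => a * u - b / u) '' (Set.Ioi 0) = Set.univ := by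
    refine Set.eq_univ_of_forall fun w => ?_
    have hs : √(w ^ 2 + 4 * a * b) ^ 2 = w ^ 2 + 4 * a * b := Real.sq_sqrt (by positivity)
    have hab : 0 < a * b := by positivity
    have hpos : 0 < w + √(w ^ 2 + 4 * a * b) := by
      have : |w| < √(w ^ 2 + 4 * a * b) := by
        rw [← Real.sqrt_sq_eq_abs]
        exact Real.sqrt_lt_sqrt (by positivity) (by linarith)
      linarith [neg_abs_le w]
    refine ⟨(w + √(w ^ 2 + 4 * a * b)) / (2 * a), ?_, ?_⟩
    · simp only [Set.mem_Ioi]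
      positivity
    · simp only
      set s := √(w ^ 2 + 4 * a * b)
      have := hpos.ne'
      field_simp
      linear_combination hs
  have habs : ∀ u ∈ Set.Ioi (0 : ℝ), |a + b / u ^ 2| • Real.exp (-(a * u - b / u) ^ 2)
      = (a + b / u ^ 2) * Real.exp (-(a * u - b / u) ^ 2) := by
    intro u hu
    rw [abs_of_pos (by positivity), smul_eq_mul]
  constructor
  · have h := (integrableOn_image_iff_integrableOn_abs_deriv_smul measurableSet_Ioi hd hinj
      (fun w : ℝ => Real.exp (-w ^ 2))).1 (by
        rw [himg]
        simpa using (integrable_exp_neg_mul_sq (b := 1) one_pos))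
    exact h.congr_fun habs measurableSet_Ioi
  · have h := integral_image_eq_integral_abs_deriv_smul measurableSet_Ioi hd hinj
      (fun w : ℝ => Real.exp (-w ^ 2))
    rw [himg, setIntegral_congr_fun measurableSet_Ioi habs] at h
    rw [← h]
    simpa using integral_gaussian 1

lemma aux_sym (a b : ℝ) (ha : 0 < a) (hb : 0 < b) :
    ∫ u in Set.Ioi (0 : ℝ), a * Real.exp (-(a * u - b / u) ^ 2) =
    ∫ u in Set.Ioi (0 : ℝ), (b / u ^ 2) * Real.exp (-(a * u - b / u) ^ 2) := by
  have hd : ∀ u ∈ Set.Ioi (0 : ℝ),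
      HasDerivWithinAt (fun u : ℝ => (b / a) * u⁻¹) ((b / a) * (-(u ^ 2)⁻¹)) (Set.Ioi 0) u :=
    fun u hu => ((hasDerivAt_inv (ne_of_gt hu)).const_mul (b / a)).hasDerivWithinAt
  have hinj : Set.InjOn (fun u : ℝ => (b / a) * u⁻¹) (Set.Ioi 0) := by
    intro u hu v hv h
    exact inv_injective (mul_left_cancel₀ (by positivity) h)
  have himg : (fun u : ℝ => (b / a) * u⁻¹) '' (Set.Ioi 0) = Set.Ioi 0 := by
    ext w
    constructor
    · rintro ⟨u, hu, rfl⟩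
      have hu0 : 0 < u := hu
      simp only [Set.mem_Ioi]
      positivity
    · intro hw
      have hw0 : 0 < w := hw
      refine ⟨(b / a) * w⁻¹, ?_, ?_⟩
      · simp only [Set.mem_Ioi]
        positivity
      · simp only
        field_simp
  have h := integral_image_eq_integral_abs_deriv_smul measurableSet_Ioi hd hinj
      (fun u : ℝ => a * Real.exp (-(a * u - b / u) ^ 2))
  rw [himg] at h
  rw [h]
  refine setIntegral_congr_fun measurableSet_Ioi fun u hu => ?_
  have hu0 : 0 < u := hu
  have e1 : |(b / a) * (-(u ^ 2)⁻¹)| = (b / a) * (u ^ 2)⁻¹ := by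
    rw [mul_neg, abs_neg, abs_of_pos (by positivity)]
  have e2 : -(a * ((b / a) * u⁻¹) - b / ((b / a) * u⁻¹)) ^ 2 = -(a * u - b / u) ^ 2 := by
    field_simp
    ring
  simp only [e1, e2, smul_eq_mul]
  field_simp

lemma aux_I (a b : ℝ) (ha : 0 < a) (hb : 0 < b) :
    ∫ u in Set.Ioi (0 : ℝ), Real.exp (-(a * u - b / u) ^ 2) = √π / (2 * a) := by
  obtain ⟨hi, hJ⟩ := aux_J a b ha hb
  have h1 : IntegrableOn (fun u : ℝ => a * Real.exp (-(a * u - b / u) ^ 2)) (Set.Ioi 0) := by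
    refine Integrable.mono' hi (by fun_prop) (ae_of_all _ fun u => ?_)
    rw [Real.norm_of_nonneg (by positivity)]
    gcongr
    have : 0 ≤ b / u ^ 2 := by positivity
    linarith
  have h2 : IntegrableOn (fun u : ℝ => (b / u ^ 2) * Real.exp (-(a * u - b / u) ^ 2))
      (Set.Ioi 0) := by
    refine Integrable.mono' hi (by fun_prop) (ae_of_all _ fun u => ?_)
    rw [Real.norm_of_nonneg (by positivity)]
    gcongr
    linarith
  simp only [add_mul] at hJ
  rw [integral_add h1 h2, ← aux_sym a b ha hb, integral_const_mul] at hJ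
  rw [eq_div_iff (by positivity)]
  linarith

/-- Laplace transform of the inverse Gaussian (Brownian first passage) density:
for x > 0 and β > 0, ∫₀^∞ e^{−βt}·x·(2π)^{−1/2}·t^{−3/2}·e^{−x²/(2t)} dt = e^{−√(2β)·x}. -/
theorem stmt_5 (x β : ℝ) (hx : 0 < x) (hβ : 0 < β) :
    ∫ t in Set.Ioi (0 : ℝ),
        Real.exp (-β * t) *
          (x * (2 * Real.pi) ^ (-(1 / 2 : ℝ)) * t ^ (-(3 / 2 : ℝ)) *
            Real.exp (-x ^ 2 / (2 * t))) =
      Real.exp (-(Real.sqrt (2 * β)) * x) := by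
  rw [← integral_comp_rpow_Ioi _ (p := -2) (by norm_num)]
  have hs2 : √2 ^ 2 = (2 : ℝ) := Real.sq_sqrt (by norm_num)
  have hsb : √β ^ 2 = β := Real.sq_sqrt hβ.le
  have key : ∀ u ∈ Set.Ioi (0 : ℝ),
      (|(-2 : ℝ)| * u ^ ((-2 : ℝ) - 1)) • (Real.exp (-β * u ^ (-2 : ℝ)) *
          (x * (2 * Real.pi) ^ (-(1 / 2 : ℝ)) * (u ^ (-2 : ℝ)) ^ (-(3 / 2 : ℝ)) *
            Real.exp (-x ^ 2 / (2 * u ^ (-2 : ℝ))))) =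
      (2 * x * (√2 * √π)⁻¹ * Real.exp (-√(2 * β) * x)) *
        Real.exp (-((x / √2) * u - √β / u) ^ 2) := by
    intro u hu
    have hu0 : 0 < u := hu
    have e1 : u ^ (-2 : ℝ) = (u ^ 2)⁻¹ := by
      rw [Real.rpow_neg hu0.le]; norm_num
    have e2 : u ^ ((-2 : ℝ) - 1) * (u ^ (-2 : ℝ)) ^ (-(3 / 2 : ℝ)) = 1 := by
      rw [← Real.rpow_mul hu0.le, ← Real.rpow_add hu0]; norm_num
    have e3 : (2 * Real.pi) ^ (-(1 / 2 : ℝ)) = (√2 * √π)⁻¹ := by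
      rw [Real.rpow_neg (by positivity), ← Real.sqrt_eq_rpow, Real.sqrt_mul (by norm_num)]
    have e4 : Real.exp (-β * u ^ (-2 : ℝ)) * Real.exp (-x ^ 2 / (2 * u ^ (-2 : ℝ))) =
        Real.exp (-√(2 * β) * x) * Real.exp (-((x / √2) * u - √β / u) ^ 2) := by
      rw [← Real.exp_add, ← Real.exp_add, e1, Real.sqrt_mul (by norm_num)]
      congr 1
      have h1 : ((x / √2) * u - √β / u) ^ 2 =
          x ^ 2 / √2 ^ 2 * u ^ 2 - √2 ^ 2 * (x / √2) * √β + √β ^ 2 / u ^ 2 := by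
        rw [hs2]; field_simp; ring_nf; try rw [hs2]
      rw [h1, hsb]
      have h2 : √2 ^ 2 * (x / √2) * √β = √2 * √β * x := by field_simp
      rw [h2, hs2]
      field_simp
      ring
    rw [smul_eq_mul, e3, abs_neg, abs_of_pos (by norm_num : (0 : ℝ) < 2)]
    linear_combination (2 * x * (√2 * √π)⁻¹ * Real.exp (-β * u ^ (-2 : ℝ)) *
      Real.exp (-x ^ 2 / (2 * u ^ (-2 : ℝ)))) * e2 + (2 * x * (√2 * √π)⁻¹) * e4
  rw [setIntegral_congr_fun measurableSet_Ioi key, integral_const_mul,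
    aux_I _ _ (by positivity) (by positivity)]
  have : √π ≠ 0 := by positivity
  field_simp
end

section
/- Let x > 0, β > 0, θ ∈ ℝ and ε ∈ ℝ, and set γ = √(2β). Define p(t) = (1 + ε·(x²/2 − θx)) · x·(2π)^{−1/2}·t^{−3/2}·e^{−x²/(2t)} + ε·(x/2)·(2πt)^{−1/2}·e^{−x²/(2t)} for t > 0. Then ∫₀^∞ e^{−βt}·p(t) dt = e^{−γx}·(1 + ε·(x²/2 + (1 − 2θγ)·x/(2γ))). -/
open Real Filter MeasureTheory

lemma aux_image (x γ : ℝ) (hx : 0 < x) (hγ : 0 < γ) :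
    (fun t : ℝ => γ * √t - x / √t) '' Set.Ioi 0 = Set.univ := by
  apply Set.eq_univ_of_forall
  intro y
  have h1 : 0 < y ^ 2 + 4 * γ * x := by positivity
  have h2 : √(y ^ 2 + 4 * γ * x) ^ 2 = y ^ 2 + 4 * γ * x := Real.sq_sqrt h1.le
  have h3 : |y| < √(y ^ 2 + 4 * γ * x) := by
    apply Real.lt_sqrt_of_sq_lt
    rw [sq_abs]
    have : 0 < γ * x := by positivity
    linarith
  have h4 : 0 < y + √(y ^ 2 + 4 * γ * x) := by
    have := neg_abs_le y
    linarith
  set s := √(y ^ 2 + 4 * γ * x)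
  have h5 : 0 < (y + s) / (2 * γ) := by positivity
  refine ⟨((y + s) / (2 * γ)) ^ 2, by simpa using pow_pos h5 2, ?_⟩
  simp only [Real.sqrt_sq h5.le]
  field_simp
  nlinarith

lemma aux_inj (x γ : ℝ) (hx : 0 < x) (hγ : 0 < γ) :
    Set.InjOn (fun t : ℝ => γ * √t - x / √t) (Set.Ioi 0) := by
  apply StrictMonoOn.injOn
  intro a ha b hb hab
  have ha' : 0 < √a := Real.sqrt_pos.2 ha
  have h : √a < √b := Real.sqrt_lt_sqrt (le_of_lt ha) hab
  have h1 : x / √b < x / √a := by gcongr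
  have h2 : γ * √a < γ * √b := by gcongr
  show γ * √a - x / √a < γ * √b - x / √b
  linarith

lemma aux_deriv_s7 (x γ : ℝ) (t : ℝ) (ht : 0 < t) :
    HasDerivAt (fun t : ℝ => γ * √t - x / √t) (γ / (2 * √t) + x / (2 * (t * √t))) t := by
  have h0 : 0 < √t := Real.sqrt_pos.2 ht
  have h := (Real.hasDerivAt_sqrt ht.ne')
  refine ((h.const_mul γ).sub ((hasDerivAt_const t x).div h h0.ne')).congr_deriv ?_
  rw [Real.sq_sqrt ht.le]
  field_simp
  ring

noncomputable def auxE (x γ t : ℝ) : ℝ := Real.exp (-(γ ^ 2 * t + x ^ 2 / t) / 2)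

lemma aux_eq (x γ : ℝ) (hx : 0 < x) (hγ : 0 < γ) (t : ℝ) (ht : 0 < t) :
    |γ / (2 * √t) + x / (2 * (t * √t))| • Real.exp (-(1/2) * (γ * √t - x / √t) ^ 2) =
      Real.exp (γ * x) * (γ / 2 * (auxE x γ t / √t) + x / 2 * (auxE x γ t / (t * √t))) := by
  have h0 : 0 < √t := Real.sqrt_pos.2 ht
  have : -(1/2) * (γ * √t - x / √t) ^ 2 = γ * x + (-(γ ^ 2 * t + x ^ 2 / t) / 2) := by
    have h1 := Real.sq_sqrt ht.le
    set r := √t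
    rw [← h1]
    field_simp
    ring
  rw [abs_of_pos (by positivity), this, Real.exp_add, auxE, smul_eq_mul]
  field_simp

lemma aux_int (x γ : ℝ) (hx : 0 < x) (hγ : 0 < γ) :
    IntegrableOn (fun t => γ / 2 * (auxE x γ t / √t) + x / 2 * (auxE x γ t / (t * √t)))
      (Set.Ioi 0) ∧
    ∫ t in Set.Ioi (0:ℝ), (γ / 2 * (auxE x γ t / √t) + x / 2 * (auxE x γ t / (t * √t))) =
      Real.exp (-(γ * x)) * √(2 * π) := by
  have hd : ∀ t ∈ Set.Ioi (0:ℝ), HasDerivWithinAt (fun t : ℝ => γ * √t - x / √t)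
    (γ / (2 * √t) + x / (2 * (t * √t))) (Set.Ioi 0) t :=
    fun t ht => (aux_deriv_s7 x γ t ht).hasDerivWithinAt
  have h1 := (integrableOn_image_iff_integrableOn_abs_deriv_smul measurableSet_Ioi hd
    (aux_inj x γ hx hγ) (fun y => Real.exp (-(1/2) * y ^ 2))).1 (by
      rw [aux_image x γ hx hγ, integrableOn_univ]
      exact integrable_exp_neg_mul_sq (by norm_num))
  have h2 := integral_image_eq_integral_abs_deriv_smul measurableSet_Ioi hd
    (aux_inj x γ hx hγ) (fun y => Real.exp (-(1/2) * y ^ 2))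
  rw [aux_image x γ hx hγ, Measure.restrict_univ, integral_gaussian,
    setIntegral_congr_fun measurableSet_Ioi (fun t ht => aux_eq x γ hx hγ t ht),
    integral_const_mul] at h2
  have h3 : IntegrableOn (fun t => Real.exp (γ * x) * (γ / 2 * (auxE x γ t / √t) +
      x / 2 * (auxE x γ t / (t * √t)))) (Set.Ioi 0) := (integrableOn_congr_fun (fun t ht => aux_eq x γ hx hγ t ht) measurableSet_Ioi).1 h1
  constructor
  · have := h3.const_mul (Real.exp (-(γ * x)))
    unfold IntegrableOn
    simpa only [← mul_assoc (Real.exp (-(γ * x))) (Real.exp (γ * x)), ← Real.exp_add,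
      neg_add_cancel, Real.exp_zero, one_mul] using this
  · have h4 : √(2 * π) = √(π / (1/2)) := by congr 1; ring
    rw [h4, h2, ← mul_assoc, ← Real.exp_add]
    simp

lemma aux_meas (x γ : ℝ) : Measurable (auxE x γ) := by
  unfold auxE; fun_prop

lemma aux_int1 (x γ : ℝ) (hx : 0 < x) (hγ : 0 < γ) :
    IntegrableOn (fun t => γ / 2 * (auxE x γ t / √t)) (Set.Ioi 0) := by
  refine (aux_int x γ hx hγ).1.mono' ?_ ?_
  · have := aux_meas x γ
    exact (by fun_prop : Measurable _).aestronglyMeasurable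
  · refine (ae_restrict_iff' measurableSet_Ioi).2 (Eventually.of_forall fun t ht => ?_)
    have ht : 0 < t := ht
    have : 0 < auxE x γ t := Real.exp_pos _
    have h0 : 0 < √t := Real.sqrt_pos.2 ht
    rw [Real.norm_of_nonneg (by positivity)]
    have : 0 < x / 2 * (auxE x γ t / (t * √t)) := by positivity
    linarith

lemma aux_int2 (x γ : ℝ) (hx : 0 < x) (hγ : 0 < γ) :
    IntegrableOn (fun t => x / 2 * (auxE x γ t / (t * √t))) (Set.Ioi 0) := by
  have := (aux_int x γ hx hγ).1.sub (aux_int1 x γ hx hγ)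
  refine this.congr (Eventually.of_forall fun t => ?_)
  simp

lemma aux_symm (x γ : ℝ) (hx : 0 < x) (hγ : 0 < γ) :
    ∫ t in Set.Ioi (0:ℝ), γ / 2 * (auxE x γ t / √t) =
      ∫ t in Set.Ioi (0:ℝ), x / 2 * (auxE x γ t / (t * √t)) := by
  have him : (fun s : ℝ => (x / γ) ^ 2 / s) '' Set.Ioi 0 = Set.Ioi 0 := by
    ext y
    constructor
    · rintro ⟨s, hs, rfl⟩
      have hs : 0 < s := hs
      show 0 < (x / γ) ^ 2 / s
      positivity
    · intro hy
      have hy : 0 < y := hy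
      refine ⟨(x / γ) ^ 2 / y, ?_, ?_⟩
      · show 0 < (x / γ) ^ 2 / y
        positivity
      · field_simp
  have hd : ∀ t ∈ Set.Ioi (0:ℝ), HasDerivWithinAt (fun s : ℝ => (x / γ) ^ 2 / s)
      (-((x / γ) ^ 2 / t ^ 2)) (Set.Ioi 0) t := by
    intro t ht
    have ht : 0 < t := ht
    apply HasDerivAt.hasDerivWithinAt
    refine ((hasDerivAt_const t ((x / γ) ^ 2)).div (hasDerivAt_id t) ht.ne').congr_deriv ?_
    simp only [id]
    ring
  have hinj : Set.InjOn (fun s : ℝ => (x / γ) ^ 2 / s) (Set.Ioi 0) := by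
    intro a ha b hb hab
    have ha : 0 < a := ha
    have hb : 0 < b := hb
    simp only at hab
    field_simp at hab
    exact hab.symm
  have h := integral_image_eq_integral_abs_deriv_smul measurableSet_Ioi hd hinj
    (fun t => γ / 2 * (auxE x γ t / √t))
  rw [him] at h
  rw [h]
  refine setIntegral_congr_fun measurableSet_Ioi fun t ht => ?_
  have ht : 0 < t := ht
  have h0 : 0 < √t := Real.sqrt_pos.2 ht
  have hE : auxE x γ ((x / γ) ^ 2 / t) = auxE x γ t := by
    unfold auxE
    congr 1
    field_simp
    ring
  have hs : √((x / γ) ^ 2 / t) = x / γ / √t := by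
    rw [Real.sqrt_div (by positivity), Real.sqrt_sq (by positivity)]
  simp only [hE, hs, abs_neg, smul_eq_mul]
  rw [abs_of_pos (by positivity)]
  have h1 := Real.sq_sqrt ht.le
  set r := √t
  field_simp
  rw [h1]
  ring

/-- The Laplace transform of the first-order perturbed OU first passage time density
equals the first-order truncation f₀ + ε·f₁ of the exact Laplace transform. -/
theorem stmt_7 (x β θ ε : ℝ) (hx : 0 < x) (hβ : 0 < β)
    (γ : ℝ) (hγ : γ = Real.sqrt (2 * β))
    (p : ℝ → ℝ)
    (hp : ∀ t : ℝ, 0 < t → p t =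
      (1 + ε * (x ^ 2 / 2 - θ * x)) *
          (x * (2 * Real.pi) ^ (-(1 / 2 : ℝ)) * t ^ (-(3 / 2 : ℝ)) *
            Real.exp (-x ^ 2 / (2 * t))) +
        ε * (x / 2) * (2 * Real.pi * t) ^ (-(1 / 2 : ℝ)) * Real.exp (-x ^ 2 / (2 * t))) :
    ∫ t in Set.Ioi (0 : ℝ), Real.exp (-β * t) * p t =
      Real.exp (-(γ * x)) * (1 + ε * (x ^ 2 / 2 + (1 - 2 * θ * γ) * x / (2 * γ))) := by
  have hγ0 : 0 < γ := by rw [hγ]; positivity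
  have hγ2 : γ ^ 2 = 2 * β := by rw [hγ]; exact Real.sq_sqrt (by positivity)
  have hq : 0 < √(2 * π) := by positivity
  have key : ∀ t ∈ Set.Ioi (0:ℝ), Real.exp (-β * t) * p t =
      (ε * x / (γ * √(2 * π))) * (γ / 2 * (auxE x γ t / √t)) +
      (2 * (1 + ε * (x ^ 2 / 2 - θ * x)) / √(2 * π)) * (x / 2 * (auxE x γ t / (t * √t))) := by
    intro t ht
    have ht : 0 < t := ht
    have h0 : 0 < √t := Real.sqrt_pos.2 ht
    have e1 : (2 * π) ^ (-(1 / 2 : ℝ)) = 1 / √(2 * π) := by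
      rw [Real.rpow_neg (by positivity), ← Real.sqrt_eq_rpow, one_div]
    have e2 : (2 * π * t) ^ (-(1 / 2 : ℝ)) = 1 / (√(2 * π) * √t) := by
      rw [Real.rpow_neg (by positivity), ← Real.sqrt_eq_rpow, one_div,
        Real.sqrt_mul (by positivity)]
    have e3 : t ^ (-(3 / 2 : ℝ)) = 1 / (t * √t) := by
      rw [Real.rpow_neg (by positivity), one_div, Real.sqrt_eq_rpow,
        show (3 / 2 : ℝ) = 1 + 1 / 2 by norm_num, Real.rpow_add ht, Real.rpow_one]
    have e4 : auxE x γ t = Real.exp (-β * t) * Real.exp (-x ^ 2 / (2 * t)) := by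
      rw [auxE, ← Real.exp_add, hγ2]
      congr 1
      field_simp
      ring
    rw [hp t ht, e1, e2, e3, e4]
    field_simp
    ring
  rw [setIntegral_congr_fun measurableSet_Ioi key,
    integral_add ((aux_int1 x γ hx hγ0).const_mul _) ((aux_int2 x γ hx hγ0).const_mul _),
    integral_const_mul (ε * x / (γ * √(2 * π))),
    integral_const_mul (2 * (1 + ε * (x ^ 2 / 2 - θ * x)) / √(2 * π))]
  have hs := (aux_int x γ hx hγ0).2
  rw [integral_add (aux_int1 x γ hx hγ0) (aux_int2 x γ hx hγ0)] at hs
  have hsy := aux_symm x γ hx hγ0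
  rw [hsy] at hs ⊢
  have hB : ∫ t in Set.Ioi (0:ℝ), x / 2 * (auxE x γ t / (t * √t)) =
      Real.exp (-(γ * x)) * √(2 * π) / 2 := by linarith
  rw [hB]
  field_simp
  ring
end

section
/- Let x > 0, β > 0, θ ∈ ℝ, and γ = √(2β). Define η(x,t) = (2π)^{−1/2}·t^{−3/2}·e^{−x²/(2t)}·[(x/2 − θ)·x + t/2 + (θx − x²/2)·(x²/t − 1)] for t > 0. Then ∫₀^∞ e^{−βt}·η(x,t) dt = e^{−γx}·(x + 1/(2γ) − θ − γ·x²/2 − x/2 + θγx). -/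
open Real Filter MeasureTheory

lemma aux_ftc {g g' : ℝ → ℝ} {l m : ℝ} (hd : ∀ t, 0 < t → HasDerivAt g (g' t) t)
    (hp : ∀ t, 0 < t → 0 ≤ g' t) (h0 : Tendsto g (nhdsWithin 0 (Set.Ioi 0)) (nhds m))
    (h1 : Tendsto g atTop (nhds l)) :
    IntegrableOn g' (Set.Ioi 0) ∧ ∫ t in Set.Ioi (0:ℝ), g' t = l - m := by
  have hc : ContinuousWithinAt (Function.update g 0 m) (Set.Ici 0) 0 := by
    rw [continuousWithinAt_update_same, Set.Ici_sdiff_left]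
    exact h0
  have hd' : ∀ t ∈ Set.Ioi (0:ℝ), HasDerivAt (Function.update g 0 m) (g' t) t := by
    intro t ht
    refine (hd t ht).congr_of_eventuallyEq ?_
    filter_upwards [lt_mem_nhds (show (0:ℝ) < t from ht)] with s hs
    exact Function.update_of_ne hs.ne' _ _
  have h1' : Tendsto (Function.update g 0 m) atTop (nhds l) := by
    refine h1.congr' ?_
    filter_upwards [eventually_gt_atTop 0] with s hs
    exact (Function.update_of_ne hs.ne' _ _).symm
  refine ⟨integrableOn_Ioi_deriv_of_nonneg hc hd' hp h1', ?_⟩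
  rw [integral_Ioi_of_hasDerivAt_of_nonneg hc hd' hp h1', Function.update_self]

noncomputable def auxPhi (u : ℝ) : ℝ := ∫ s in (0:ℝ)..u, Real.exp (-(1/2) * s ^ 2)

lemma auxPhi_deriv (u : ℝ) : HasDerivAt auxPhi (Real.exp (-(1/2) * u ^ 2)) u := by
  have hc : Continuous (fun s : ℝ => Real.exp (-(1/2) * s ^ 2)) := by fun_prop
  exact intervalIntegral.integral_hasDerivAt_right (hc.intervalIntegrable _ _)
    hc.stronglyMeasurable.stronglyMeasurableAtFilter hc.continuousAt

lemma auxPhi_top : Tendsto auxPhi atTop (nhds (√(2 * π) / 2)) := by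
  have h := intervalIntegral_tendsto_integral_Ioi (0:ℝ)
    (integrable_exp_neg_mul_sq (b := 1/2) (by norm_num)).integrableOn tendsto_id
  rw [integral_gaussian_Ioi] at h
  have e : π / (1/2) = 2 * π := by ring
  rw [e] at h
  exact h

lemma auxPhi_neg (u : ℝ) : auxPhi (-u) = - auxPhi u := by
  have h := intervalIntegral.integral_comp_neg (a := 0) (b := u)
    (fun s : ℝ => Real.exp (-(1/2) * s ^ 2))
  simp only [neg_sq, neg_zero] at h
  unfold auxPhi
  rw [h, intervalIntegral.integral_symm]

lemma auxPhi_bot : Tendsto auxPhi atBot (nhds (-(√(2 * π) / 2))) := by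
  have h := (auxPhi_top.comp tendsto_neg_atBot_atTop).neg
  refine h.congr ?_
  intro u
  simp [auxPhi_neg]

lemma sqrt_zero_right : Tendsto (fun t : ℝ => √t) (nhdsWithin 0 (Set.Ioi 0))
    (nhdsWithin 0 (Set.Ioi 0)) := by
  refine tendsto_nhdsWithin_iff.2 ⟨?_, ?_⟩
  · have := (Real.continuous_sqrt.tendsto 0).mono_left
      (nhdsWithin_le_nhds (s := Set.Ioi (0:ℝ)))
    simpa using this
  · filter_upwards [self_mem_nhdsWithin] with t ht
    exact Real.sqrt_pos.2 ht

lemma arg_zero (a x : ℝ) (hx : 0 < x) :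
    Tendsto (fun t : ℝ => a * √t - x * (√t)⁻¹) (nhdsWithin 0 (Set.Ioi 0)) atBot := by
  have h1 : Tendsto (fun t : ℝ => a * √t) (nhdsWithin 0 (Set.Ioi 0)) (nhds (a * 0)) :=
    (tendsto_nhds_of_tendsto_nhdsWithin sqrt_zero_right).const_mul a
  have h2 : Tendsto (fun t : ℝ => x * (√t)⁻¹) (nhdsWithin 0 (Set.Ioi 0)) atTop :=
    (tendsto_inv_nhdsGT_zero.comp sqrt_zero_right).const_mul_atTop hx
  simpa [sub_eq_add_neg] using h1.add_atBot (tendsto_neg_atTop_atBot.comp h2)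

lemma inv_sqrt_top : Tendsto (fun t : ℝ => (√t)⁻¹) atTop (nhds 0) :=
  tendsto_inv_atTop_zero.comp tendsto_sqrt_atTop

lemma arg_top (a x : ℝ) (ha : 0 < a) :
    Tendsto (fun t : ℝ => a * √t - x * (√t)⁻¹) atTop atTop := by
  have h1 : Tendsto (fun t : ℝ => a * √t) atTop atTop :=
    tendsto_sqrt_atTop.const_mul_atTop ha
  simpa [sub_eq_add_neg] using h1.atTop_add (inv_sqrt_top.const_mul x).neg

lemma arg_bot (a x : ℝ) (ha : a < 0) :
    Tendsto (fun t : ℝ => a * √t - x * (√t)⁻¹) atTop atBot := by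
  have h := tendsto_neg_atTop_atBot.comp (arg_top (-a) (-x) (by linarith))
  refine h.congr ?_
  intro t
  simp only [Function.comp]
  ring

lemma A_deriv (a x β t : ℝ) (ha : a ^ 2 = 2 * β) (ht : 0 < t) :
    HasDerivAt (fun t : ℝ => auxPhi (a * √t - x * (√t)⁻¹))
      (Real.exp (a * x) * (Real.exp (-β * t) * Real.exp (-x ^ 2 / (2 * t))) *
        (a / 2 * (√t)⁻¹ + x / 2 * (√t)⁻¹ ^ 3)) t := by
  have hs : 0 < √t := Real.sqrt_pos.2 ht
  have h1 := Real.hasDerivAt_sqrt ht.ne'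
  have h2 := (h1.const_mul a).sub ((h1.inv hs.ne').const_mul x)
  have h3 := (auxPhi_deriv (a * √t - x * (√t)⁻¹)).comp t h2
  refine h3.congr_deriv ?_
  rw [← Real.exp_add, ← Real.exp_add]
  congr 1
  · congr 1
    have e : t = √t ^ 2 := (Real.sq_sqrt ht.le).symm
    have hb : β = a ^ 2 / 2 := by linarith
    rw [hb]
    generalize √t = s at *
    subst e
    field_simp
    ring
  · field_simp
    ring

lemma C_deriv (x β t : ℝ) (ht : 0 < t) :
    HasDerivAt (fun t : ℝ => (√t)⁻¹ * (Real.exp (-β * t) * Real.exp (-x ^ 2 / (2 * t))))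
      ((Real.exp (-β * t) * Real.exp (-x ^ 2 / (2 * t))) *
        (-β * (√t)⁻¹ + x ^ 2 / 2 * (√t)⁻¹ ^ 5 - 1 / 2 * (√t)⁻¹ ^ 3)) t := by
  have hs : 0 < √t := Real.sqrt_pos.2 ht
  have h1 := Real.hasDerivAt_sqrt ht.ne'
  have h2 := ((hasDerivAt_id t).const_mul (-β)).exp
  have h3 := ((hasDerivAt_const t (-x ^ 2)).div ((hasDerivAt_id t).const_mul 2)
    (by simpa using ht.ne')).exp
  have h4 := (h1.inv hs.ne').mul (h2.mul h3)
  refine h4.congr_deriv ?_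
  have e : t = √t ^ 2 := (Real.sq_sqrt ht.le).symm
  simp only [id, Pi.div_apply, Pi.mul_apply, Pi.inv_apply]
  generalize Real.exp (-β * t) = E1 at *
  generalize Real.exp (-x ^ 2 / (2 * t)) = E2 at *
  clear h1 h2 h3 h4
  generalize √t = s at *
  subst e
  field_simp
  ring

lemma C_top (x β : ℝ) (hβ : 0 < β) :
    Tendsto (fun t : ℝ => (√t)⁻¹ * (Real.exp (-β * t) * Real.exp (-x ^ 2 / (2 * t))))
      atTop (nhds 0) := by
  refine squeeze_zero' ?_ ?_ inv_sqrt_top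
  · exact Eventually.of_forall fun t => by positivity
  · filter_upwards [eventually_gt_atTop 0] with t ht
    have h1 : Real.exp (-β * t) ≤ 1 := Real.exp_le_one_iff.2 (by nlinarith)
    have h2 : Real.exp (-x ^ 2 / (2 * t)) ≤ 1 := by
      refine Real.exp_le_one_iff.2 ?_
      rw [neg_div]
      have : 0 ≤ x ^ 2 / (2 * t) := by positivity
      linarith
    have h3 := mul_le_one₀ h1 (Real.exp_pos _).le h2
    exact mul_le_of_le_one_right (by positivity) h3

lemma C_zero (x β : ℝ) (hx : 0 < x) (hβ : 0 < β) :
    Tendsto (fun t : ℝ => (√t)⁻¹ * (Real.exp (-β * t) * Real.exp (-x ^ 2 / (2 * t))))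
      (nhdsWithin 0 (Set.Ioi 0)) (nhds 0) := by
  have hl : Tendsto (fun t : ℝ => 2 / x ^ 2 * √t) (nhdsWithin 0 (Set.Ioi 0)) (nhds 0) := by
    simpa using (tendsto_nhds_of_tendsto_nhdsWithin sqrt_zero_right).const_mul (2 / x ^ 2)
  refine squeeze_zero' ?_ ?_ hl
  · exact Eventually.of_forall fun t => by positivity
  · filter_upwards [self_mem_nhdsWithin] with t ht
    have ht : 0 < t := ht
    have hs : 0 < √t := Real.sqrt_pos.2 ht
    have h1 : Real.exp (-β * t) ≤ 1 := Real.exp_le_one_iff.2 (by nlinarith)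
    have h2 : Real.exp (-x ^ 2 / (2 * t)) ≤ 2 * t / x ^ 2 := by
      have hy : 0 < x ^ 2 / (2 * t) := by positivity
      have := Real.add_one_le_exp (x ^ 2 / (2 * t))
      rw [neg_div, Real.exp_neg, ← inv_div (x ^ 2) (2 * t)]
      have h5 : x ^ 2 / (2 * t) ≤ Real.exp (x ^ 2 / (2 * t)) := by linarith
      exact inv_anti₀ hy h5
    calc _ ≤ (√t)⁻¹ * (1 * (2 * t / x ^ 2)) := by gcongr
      _ = _ := by
        nth_rewrite 2 [← Real.sq_sqrt ht.le]
        field_simp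

lemma rpow_half (t : ℝ) (ht : 0 < t) : t ^ (-(1 / 2 : ℝ)) = (√t)⁻¹ := by
  rw [Real.rpow_neg ht.le, Real.sqrt_eq_rpow]

lemma rpow_three (t : ℝ) (ht : 0 < t) : t ^ (-(3 / 2 : ℝ)) = (√t)⁻¹ ^ 3 := by
  rw [← rpow_half t ht, ← Real.rpow_natCast, ← Real.rpow_mul ht.le]
  norm_num

/-- Laplace transform of the η-function of the first-order OU perturbation:
∫₀^∞ e^{−βt}·η(x,t) dt = e^{−γx}·(x + 1/(2γ) − θ − γx²/2 − x/2 + θγx), γ = √(2β). -/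
theorem stmt_9 (x β θ : ℝ) (hx : 0 < x) (hβ : 0 < β)
    (γ : ℝ) (hγ : γ = Real.sqrt (2 * β))
    (η : ℝ → ℝ → ℝ)
    (hη : ∀ t : ℝ, 0 < t → η x t =
      (2 * Real.pi) ^ (-(1 / 2 : ℝ)) * t ^ (-(3 / 2 : ℝ)) * Real.exp (-x ^ 2 / (2 * t)) *
        ((x / 2 - θ) * x + t / 2 + (θ * x - x ^ 2 / 2) * (x ^ 2 / t - 1))) :
    ∫ t in Set.Ioi (0 : ℝ), Real.exp (-β * t) * η x t =
      Real.exp (-(γ * x)) *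
        (x + 1 / (2 * γ) - θ - γ * x ^ 2 / 2 - x / 2 + θ * γ * x) := by
  have hγ0 : 0 < γ := by rw [hγ]; positivity
  have hγ2 : γ ^ 2 = 2 * β := by rw [hγ]; exact Real.sq_sqrt (by positivity)
  set L : ℝ := √(2 * π) / 2 with hL
  have hLpos : 0 < √(2 * π) := by positivity
  set E : ℝ → ℝ := fun t => Real.exp (-β * t) * Real.exp (-x ^ 2 / (2 * t)) with hE
  have hEpos : ∀ t, 0 < E t := fun t => by simp only [hE]; positivity
  set A : ℝ → ℝ := fun t => auxPhi (γ * √t - x * (√t)⁻¹) with hA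
  set B : ℝ → ℝ := fun t => auxPhi ((-γ) * √t - x * (√t)⁻¹) with hB
  have hA0 : Tendsto A (nhdsWithin 0 (Set.Ioi 0)) (nhds (-L)) := auxPhi_bot.comp (arg_zero γ x hx)
  have hB0 : Tendsto B (nhdsWithin 0 (Set.Ioi 0)) (nhds (-L)) :=
    auxPhi_bot.comp (arg_zero (-γ) x hx)
  have hA1 : Tendsto A atTop (nhds L) := auxPhi_top.comp (arg_top γ x hγ0)
  have hB1 : Tendsto B atTop (nhds (-L)) := auxPhi_bot.comp (arg_bot (-γ) x (by linarith))
  have hAd := fun t ht => A_deriv γ x β t hγ2 ht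
  have hBd := fun t ht => A_deriv (-γ) x β t (by rw [neg_sq]; exact hγ2) ht
  have hmul : Real.exp (γ * x) * Real.exp (-(γ * x)) = 1 := by
    rw [← Real.exp_add]; simp
  set P := Real.exp (γ * x) with hP
  set Q := Real.exp (-(γ * x)) with hQ
  have hnn : Real.exp (-γ * x) = Q := by rw [hQ]; congr 1; ring
  rw [hnn] at hBd
  have d1 : ∀ t, 0 < t → HasDerivAt (fun t => (Q * A t - P * B t) / γ) (E t * (√t)⁻¹) t := by
    intro t ht
    refine ((((hAd t ht).const_mul Q).sub ((hBd t ht).const_mul P)).div_const γ).congr_deriv ?_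
    change (Q * (P * E t * _) - P * (Q * E t * _)) / γ = _
    rw [div_eq_iff hγ0.ne']
    linear_combination (E t * γ * (√t)⁻¹) * hmul
  have d2 : ∀ t, 0 < t → HasDerivAt (fun t => (Q * A t + P * B t) / x) (E t * (√t)⁻¹ ^ 3) t := by
    intro t ht
    refine ((((hAd t ht).const_mul Q).add ((hBd t ht).const_mul P)).div_const x).congr_deriv ?_
    change (Q * (P * E t * _) + P * (Q * E t * _)) / x = _
    rw [div_eq_iff hx.ne']
    linear_combination (E t * x * (√t)⁻¹ ^ 3) * hmul
  have d3 : ∀ t, 0 < t → HasDerivAt (fun t => ((√t)⁻¹ * E t + β * ((Q * A t - P * B t) / γ)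
      + 1 / 2 * ((Q * A t + P * B t) / x)) * (2 / x ^ 2)) (E t * (√t)⁻¹ ^ 5) t := by
    intro t ht
    refine ((((C_deriv x β t ht).add ((d1 t ht).const_mul β)).add
      ((d2 t ht).const_mul (1/2))).mul_const (2 / x ^ 2)).congr_deriv ?_
    change (E t * _ + _ + _) * _ = _
    field_simp
    ring
  have z1 := ((hA0.const_mul Q).sub (hB0.const_mul P)).div_const γ
  have t1 := ((hA1.const_mul Q).sub (hB1.const_mul P)).div_const γ
  have z2 := ((hA0.const_mul Q).add (hB0.const_mul P)).div_const x
  have t2 := ((hA1.const_mul Q).add (hB1.const_mul P)).div_const x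
  have z3 := (((C_zero x β hx hβ).add (z1.const_mul β)).add (z2.const_mul (1/2))).mul_const
    (2 / x ^ 2)
  have t3 := (((C_top x β hβ).add (t1.const_mul β)).add (t2.const_mul (1/2))).mul_const
    (2 / x ^ 2)
  obtain ⟨i1, e1⟩ := aux_ftc d1 (fun t _ => by have := hEpos t; positivity) z1 t1
  obtain ⟨i2, e2⟩ := aux_ftc d2 (fun t _ => by have := hEpos t; positivity) z2 t2
  obtain ⟨i3, e3⟩ := aux_ftc d3 (fun t _ => by have := hEpos t; positivity) z3 t3
  have key : ∀ t ∈ Set.Ioi (0:ℝ), Real.exp (-β * t) * η x t =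
      (√(2 * π))⁻¹ * (1 / 2) * (E t * (√t)⁻¹)
      + (√(2 * π))⁻¹ * ((x / 2 - θ) * x - (θ * x - x ^ 2 / 2)) * (E t * (√t)⁻¹ ^ 3)
      + (√(2 * π))⁻¹ * ((θ * x - x ^ 2 / 2) * x ^ 2) * (E t * (√t)⁻¹ ^ 5) := by
    intro t ht
    have ht : 0 < t := ht
    have hs : 0 < √t := Real.sqrt_pos.2 ht
    rw [hη t ht, rpow_half _ (by positivity), rpow_three t ht]
    simp only [hE]
    have e : t = √t ^ 2 := (Real.sq_sqrt ht.le).symm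
    generalize Real.exp (-β * t) = E1 at *
    generalize Real.exp (-x ^ 2 / (2 * t)) = E2 at *
    have e' : x ^ 2 / t = x ^ 2 * (√t)⁻¹ ^ 2 := by
      nth_rewrite 1 [e]
      field_simp
    have e'' : t * (√t)⁻¹ ^ 3 = (√t)⁻¹ := by
      nth_rewrite 1 [e]
      field_simp
    rw [e']
    linear_combination ((√(2 * π))⁻¹ * E1 * E2 / 2) * e''
  rw [setIntegral_congr_fun measurableSet_Ioi key, integral_add, integral_add,
    integral_const_mul, integral_const_mul, integral_const_mul, e1, e2, e3]
  · have hβ' : β = γ ^ 2 / 2 := by linarith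
    have hL' : (√(2 * π)) = 2 * L := by rw [hL]; ring
    have hL0 : 0 < L := by rw [hL]; positivity
    rw [hL', hβ']
    field_simp
    ring
  · exact i1.const_mul _
  · exact i2.const_mul _
  · exact (i1.const_mul _).add (i2.const_mul _)
  · exact i3.const_mul _
end

section
/- Let 0 < a < x, β > 0 and γ = √(2β). Define f₀(x) = e^{−γ(x−a)} and f₁(x) = f₀(x) · (ln(a/x) + e^{2γa}·E₁(2γa) − e^{2γx}·E₁(2γx))/2. Then f₁ satisfies (1/2)·f₁''(x) = β·f₁(x) − (1/(2x))·f₀'(x) for all x > a, together with f₁(a) = 0 and f₁(x) → 0 as x → ∞. -/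
open Real Filter MeasureTheory

/-- The exponential integral E₁(z) = ∫_z^∞ e^{−u}/u du. -/
noncomputable def E1 (z : ℝ) : ℝ := ∫ u in Set.Ioi z, Real.exp (-u) / u

lemma E1_int {z : ℝ} (hz : 0 < z) : IntegrableOn (fun u => Real.exp (-u) / u) (Set.Ioi z) := by
  have h1 : IntegrableOn (fun u : ℝ => Real.exp (-u) * z⁻¹) (Set.Ioi z) :=
    (integrableOn_exp_neg_Ioi z).mul_const _
  refine Integrable.mono' h1 ?_ ?_
  · exact (by fun_prop : Measurable fun u : ℝ => Real.exp (-u) / u).aestronglyMeasurable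
  · refine (ae_restrict_iff' measurableSet_Ioi).2 (Eventually.of_forall fun u hu => ?_)
    have hu' : z < u := hu
    have : 0 < u := hz.trans hu'
    rw [Real.norm_of_nonneg (by positivity), div_eq_mul_inv]
    gcongr

lemma E1_nonneg {z : ℝ} (hz : 0 < z) : 0 ≤ E1 z := by
  refine setIntegral_nonneg measurableSet_Ioi fun u hu => ?_
  have : 0 < u := hz.trans hu
  positivity

lemma E1_le {z : ℝ} (hz : 0 < z) : E1 z ≤ Real.exp (-z) * z⁻¹ := by
  rw [← integral_exp_neg_Ioi z, ← integral_mul_const]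
  refine setIntegral_mono_on (E1_int hz) ((integrableOn_exp_neg_Ioi z).mul_const _)
    measurableSet_Ioi fun u hu => ?_
  have hu' : z < u := hu
  have : 0 < u := hz.trans hu'
  rw [div_eq_mul_inv]
  gcongr

lemma E1_deriv {z : ℝ} (hz : 0 < z) : HasDerivAt E1 (-(Real.exp (-z) / z)) z := by
  have hc : 0 < z / 2 := by positivity
  have hev : E1 =ᶠ[nhds z] fun y => E1 (z/2) - ∫ u in (z/2)..y, Real.exp (-u) / u := by
    filter_upwards [lt_mem_nhds (show z / 2 < z by linarith)] with y hy
    have h := intervalIntegral.integral_Ioi_sub_Ioi (E1_int hc) hy.le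
    unfold E1
    rw [← h]; ring
  have hcont : ContinuousOn (fun u : ℝ => Real.exp (-u) / u) (Set.Ioi 0) :=
    ContinuousOn.div (by fun_prop) (by fun_prop) fun u hu => ne_of_gt hu
  have hd : HasDerivAt (fun y => ∫ u in (z/2)..y, Real.exp (-u) / u) (Real.exp (-z) / z) z := by
    refine intervalIntegral.integral_hasDerivAt_right ?_ ?_ ?_
    · refine (hcont.mono fun u hu => ?_).intervalIntegrable
      rw [Set.uIcc_of_le (by linarith)] at hu
      exact lt_of_lt_of_le hc hu.1
    · exact (by fun_prop : Measurable fun u : ℝ => Real.exp (-u) / u).stronglyMeasurable.stronglyMeasurableAtFilter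
    · exact hcont.continuousAt (Ioi_mem_nhds hz)
  exact (hd.const_sub _).congr_of_eventuallyEq hev

lemma H_deriv {γ x : ℝ} (hγ : 0 < γ) (hx : 0 < x) :
    HasDerivAt (fun x => Real.exp (2 * γ * x) * E1 (2 * γ * x))
      (2 * γ * (Real.exp (2 * γ * x) * E1 (2 * γ * x)) - 1 / x) x := by
  have hl : HasDerivAt (fun x : ℝ => 2 * γ * x) (2 * γ) x := by
    simpa using (hasDerivAt_id x).const_mul (2 * γ)
  have h := hl.exp.mul ((E1_deriv (show 0 < 2 * γ * x by positivity)).comp x hl)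
  refine h.congr_deriv ?_
  simp only [Function.comp]
  rw [Real.exp_neg]
  field_simp
  ring

/-- For the Bessel process BES(1+ε) with drift h(x) = 1/(2x), the first-order
perturbation term f₁ = f₀·(ln(a/x) + e^{2γa}E₁(2γa) − e^{2γx}E₁(2γx))/2 solves
(1/2)f₁'' = β·f₁ − (1/(2x))·f₀' on (a,∞), with f₁(a) = 0 and f₁(x) → 0 as x → ∞. -/
theorem stmt_10 (a β : ℝ) (ha : 0 < a) (hβ : 0 < β)
    (γ : ℝ) (hγ : γ = Real.sqrt (2 * β))
    (f₀ f₁ : ℝ → ℝ)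
    (hf₀ : ∀ x : ℝ, f₀ x = Real.exp (-(γ * (x - a))))
    (hf₁ : ∀ x : ℝ, f₁ x =
      f₀ x * (Real.log (a / x) + Real.exp (2 * γ * a) * E1 (2 * γ * a) -
        Real.exp (2 * γ * x) * E1 (2 * γ * x)) / 2) :
    (∀ x : ℝ, a < x →
      (1 / 2) * deriv (deriv f₁) x = β * f₁ x - (1 / (2 * x)) * deriv f₀ x) ∧
    f₁ a = 0 ∧
    Tendsto f₁ atTop (nhds 0) := by
  have hg : 0 < γ := by rw [hγ]; positivity
  have hg2 : γ ^ 2 = 2 * β := by rw [hγ]; exact Real.sq_sqrt (by positivity)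
  have hf0' : ∀ x, HasDerivAt f₀ (-γ * f₀ x) x := by
    intro x
    have h1 : HasDerivAt (fun x : ℝ => -(γ * (x - a))) (-γ) x := by
      exact ((((hasDerivAt_id x).sub_const a).const_mul γ).neg).congr_deriv (by ring)
    have h2 : f₀ = fun x => Real.exp (-(γ * (x - a))) := funext hf₀
    rw [h2]
    exact h1.exp.congr_deriv (by ring)
  set H : ℝ → ℝ := fun x => Real.exp (2 * γ * x) * E1 (2 * γ * x) with hH
  have hHd : ∀ x, 0 < x → HasDerivAt H (2 * γ * H x - 1 / x) x := fun x hx => H_deriv hg hx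
  set G : ℝ → ℝ := fun x => Real.log (a / x) + H a - H x with hG
  have hGd : ∀ x, 0 < x → HasDerivAt G (-2 * γ * H x) x := by
    intro x hx
    have h1 : HasDerivAt (fun x : ℝ => Real.log (a / x)) (-(1 / x)) x := by
      have h2 : HasDerivAt (fun x : ℝ => Real.log a - Real.log x) (-(1 / x)) x := by
        simpa using (Real.hasDerivAt_log hx.ne').const_sub (Real.log a)
      refine h2.congr_of_eventuallyEq ?_
      filter_upwards [lt_mem_nhds hx] with y hy
      exact Real.log_div ha.ne' hy.ne'
    exact ((h1.add_const (H a)).sub (hHd x hx)).congr_deriv (by ring)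
  have hf1 : f₁ = fun x => f₀ x * G x / 2 := funext hf₁
  have hd1 : ∀ x, 0 < x → HasDerivAt f₁ (f₀ x * (-γ * G x - 2 * γ * H x) / 2) x := by
    intro x hx
    rw [hf1]
    exact (((hf0' x).mul (hGd x hx)).div_const 2).congr_deriv (by ring)
  refine ⟨?_, ?_, ?_⟩
  · intro x hx
    have hx0 : 0 < x := ha.trans hx
    have hev : deriv f₁ =ᶠ[nhds x] fun x => f₀ x * (-γ * G x - 2 * γ * H x) / 2 := by
      filter_upwards [lt_mem_nhds hx0] with y hy
      exact (hd1 y hy).deriv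
    have hd2 := (((hf0' x).mul (((hGd x hx0).const_mul (-γ)).sub
      ((hHd x hx0).const_mul (2 * γ)))).div_const 2)
    have hd3 := (hd2.congr_of_eventuallyEq hev).deriv
    rw [hd3, (hf0' x).deriv, hf1]
    have hb : β = γ ^ 2 / 2 := by linarith
    rw [hb]
    simp only [Pi.sub_apply]
    field_simp
    ring
  · rw [hf1]
    simp [hG, div_self ha.ne']
  · have hlin : Tendsto (fun x : ℝ => γ * (x - a)) atTop atTop :=
      (tendsto_atTop_add_const_right _ (-a) tendsto_id).const_mul_atTop hg
    have h0 : Tendsto f₀ atTop (nhds 0) := by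
      rw [funext hf₀]
      exact Real.tendsto_exp_neg_atTop_nhds_zero.comp hlin
    have hHl : Tendsto H atTop (nhds 0) := by
      have hz : Tendsto (fun x : ℝ => (2 * γ * x)⁻¹) atTop (nhds 0) :=
        tendsto_inv_atTop_zero.comp (tendsto_id.const_mul_atTop (by positivity))
      refine squeeze_zero' ?_ ?_ hz
      · filter_upwards [eventually_gt_atTop 0] with x hx
        exact mul_nonneg (Real.exp_pos _).le (E1_nonneg (by positivity))
      · filter_upwards [eventually_gt_atTop 0] with x hx
        have h := mul_le_mul_of_nonneg_left (E1_le (show 0 < 2 * γ * x by positivity))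
          (Real.exp_pos (2 * γ * x)).le
        rwa [← mul_assoc, ← Real.exp_add, add_neg_cancel, Real.exp_zero, one_mul] at h
    have hlog : Tendsto (fun x => f₀ x * Real.log x) atTop (nhds 0) := by
      have h1 : (fun x : ℝ => x) =o[atTop] fun x => Real.exp (γ * x) := by
        simpa using isLittleO_pow_exp_pos_mul_atTop 1 hg
      have h2 := (Real.isLittleO_log_id_atTop.trans h1).tendsto_div_nhds_zero
      have h3 := h2.const_mul (Real.exp (γ * a))
      rw [mul_zero] at h3
      refine h3.congr fun x => ?_
      rw [hf₀, show -(γ * (x - a)) = γ * a - γ * x by ring, Real.exp_sub]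
      ring
    have hfin := (((h0.mul_const (Real.log a + H a)).sub hlog).sub (h0.mul hHl)).div_const 2
    simp only [zero_mul, mul_zero, sub_zero, zero_div] at hfin
    refine hfin.congr' ?_
    filter_upwards [eventually_gt_atTop 0] with x hx
    rw [hf1]
    simp only [hG]
    rw [Real.log_div ha.ne' hx.ne']
    ring
end

section
/- Let 0 < a < x, ε ∈ ℝ, β > 0 and γ = √(2β). Define p(t) = (1 + (ε/2)·ln(a/x)) · (x−a)·(2π)^{−1/2}·t^{−3/2}·e^{−(x−a)²/(2t)} + ε·(x−a)·(2πt)^{−1/2} · ∫_{(x−a)²}^∞ (2t)^{−1}·e^{−y/(2t)} / ((√y − x + 3a)·(√y + x + a)) dy for t > 0. Then ∫₀^∞ e^{−βt}·p(t) dt = e^{−γ(x−a)} · (1 + (ε/2)·(ln(a/x) + e^{2γa}·E₁(2γa) − e^{2γx}·E₁(2γx))). -/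
open Real Filter MeasureTheory

noncomputable def GG (z : ℝ) : ℝ := ∫ s in (0:ℝ)..z, Real.exp (-(1/2) * s ^ 2)

lemma GG_deriv (z : ℝ) : HasDerivAt GG (Real.exp (-(1/2) * z ^ 2)) z := by
  have hc : Continuous (fun s : ℝ => Real.exp (-(1/2) * s ^ 2)) := by fun_prop
  exact intervalIntegral.integral_hasDerivAt_right (hc.intervalIntegrable _ _)
    (hc.stronglyMeasurableAtFilter _ _) hc.continuousAt

lemma GG_top : Tendsto GG atTop (nhds (Real.sqrt (2 * Real.pi) / 2)) := by
  have h := intervalIntegral_tendsto_integral_Ioi (0:ℝ)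
    (integrable_exp_neg_mul_sq (b := 1/2) (by norm_num)).integrableOn tendsto_id
  rw [integral_gaussian_Ioi] at h
  have e : Real.pi / (1/2) = 2 * Real.pi := by ring
  rw [e] at h
  exact h

lemma GG_neg (z : ℝ) : GG (-z) = - GG z := by
  unfold GG
  have := intervalIntegral.integral_comp_neg (a := 0) (b := z) (fun s : ℝ => Real.exp (-(1/2) * s ^ 2))
  simp only [neg_sq, neg_zero] at this
  rw [intervalIntegral.integral_symm, ← this]

lemma GG_bot : Tendsto GG atBot (nhds (-(Real.sqrt (2 * Real.pi) / 2))) := by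
  have h := (GG_top.comp tendsto_neg_atBot_atTop).neg
  refine h.congr fun z => ?_
  simp [GG_neg]

noncomputable def FF (γ v t : ℝ) : ℝ :=
  Real.exp (-(γ * v)) * GG (γ * √t - v * (√t)⁻¹) - Real.exp (γ * v) * GG (γ * √t + v * (√t)⁻¹)

lemma FF_deriv (γ v t : ℝ) (ht : 0 < t) :
    HasDerivAt (FF γ v) (v / (t * √t) * Real.exp (-(γ ^ 2 / 2) * t - v ^ 2 / (2 * t))) t := by
  have hs : 0 < √t := Real.sqrt_pos.2 ht
  have h1 := Real.hasDerivAt_sqrt ht.ne'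
  have h2 := h1.inv hs.ne'
  have hm := (GG_deriv _).comp t ((h1.const_mul γ).sub (h2.const_mul v))
  have hp := (GG_deriv _).comp t ((h1.const_mul γ).add (h2.const_mul v))
  have h := (hm.const_mul (Real.exp (-(γ * v)))).sub (hp.const_mul (Real.exp (γ * v)))
  refine h.congr_deriv ?_
  simp only [Pi.sub_apply, Pi.add_apply, Pi.inv_apply, ← mul_assoc, ← Real.exp_add]
  have e1 : -(γ * v) + -(1/2) * (γ * √t - v * (√t)⁻¹) ^ 2 = -(γ ^ 2 / 2) * t - v ^ 2 / (2 * t) := by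
    have : t = √t ^ 2 := (Real.sq_sqrt ht.le).symm
    generalize √t = s at *
    subst this
    field_simp
    ring
  have e2 : (γ * v) + -(1/2) * (γ * √t + v * (√t)⁻¹) ^ 2 = -(γ ^ 2 / 2) * t - v ^ 2 / (2 * t) := by
    have : t = √t ^ 2 := (Real.sq_sqrt ht.le).symm
    generalize √t = s at *
    subst this
    field_simp
    ring
  rw [e1, e2]
  generalize Real.exp (-(γ ^ 2 / 2) * t - v ^ 2 / (2 * t)) = E
  have : t = √t ^ 2 := (Real.sq_sqrt ht.le).symm
  generalize √t = s at *
  subst this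
  field_simp
  ring

lemma FF_top (γ v : ℝ) (hγ : 0 < γ) : Tendsto (FF γ v) atTop
    (nhds (Real.exp (-(γ * v)) * (√(2 * Real.pi) / 2) - Real.exp (γ * v) * (√(2 * Real.pi) / 2))) := by
  have hs : Tendsto (fun t : ℝ => √t) atTop atTop := Real.tendsto_sqrt_atTop
  have hi : Tendsto (fun t : ℝ => v * (√t)⁻¹) atTop (nhds (v * 0)) :=
    (tendsto_inv_atTop_zero.comp hs).const_mul v
  have hg : Tendsto (fun t : ℝ => γ * √t) atTop atTop := hs.const_mul_atTop hγ
  exact ((GG_top.comp (by simpa [sub_eq_add_neg] using hg.atTop_add hi.neg)).const_mul _).sub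
    ((GG_top.comp (hg.atTop_add hi)).const_mul _)

lemma FF_zero (γ v : ℝ) (hv : 0 < v) : Tendsto (FF γ v) (nhdsWithin 0 (Set.Ioi 0))
    (nhds (Real.exp (-(γ * v)) * (-(√(2 * Real.pi) / 2)) - Real.exp (γ * v) * (√(2 * Real.pi) / 2))) := by
  have h0 : Tendsto (fun t : ℝ => √t) (nhdsWithin 0 (Set.Ioi 0)) (nhds 0) := by
    have : Tendsto (fun t : ℝ => √t) (nhds 0) (nhds (√0)) := Real.continuous_sqrt.continuousAt
    rw [Real.sqrt_zero] at this
    exact this.mono_left nhdsWithin_le_nhds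
  have hs : Tendsto (fun t : ℝ => √t) (nhdsWithin 0 (Set.Ioi 0)) (nhdsWithin 0 (Set.Ioi 0)) := by
    refine tendsto_nhdsWithin_iff.2 ⟨h0, ?_⟩
    filter_upwards [self_mem_nhdsWithin] with t ht
    exact Real.sqrt_pos.2 ht
  have hi : Tendsto (fun t : ℝ => v * (√t)⁻¹) (nhdsWithin 0 (Set.Ioi 0)) atTop :=
    (tendsto_inv_nhdsGT_zero.comp hs).const_mul_atTop hv
  have hg := h0.const_mul γ
  have hb : Tendsto (fun t : ℝ => γ * √t - v * (√t)⁻¹) (nhdsWithin 0 (Set.Ioi 0)) atBot := by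
    simpa [sub_eq_add_neg] using hg.add_atBot (tendsto_neg_atTop_atBot.comp hi)
  exact ((GG_bot.comp hb).const_mul _).sub
    ((GG_top.comp (hg.add_atTop hi)).const_mul _)

lemma kernel_int (γ v : ℝ) (hγ : 0 < γ) (hv : 0 < v) :
    IntegrableOn (fun t => v / (t * √t) * Real.exp (-(γ ^ 2 / 2) * t - v ^ 2 / (2 * t))) (Set.Ioi 0) ∧
    ∫ t in Set.Ioi (0:ℝ), v / (t * √t) * Real.exp (-(γ ^ 2 / 2) * t - v ^ 2 / (2 * t)) =
      √(2 * Real.pi) * Real.exp (-(γ * v)) := by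
  set L := (Real.exp (-(γ * v)) * (-(√(2 * Real.pi) / 2)) - Real.exp (γ * v) * (√(2 * Real.pi) / 2)) with hL
  have hc : ContinuousWithinAt (Function.update (FF γ v) 0 L) (Set.Ici 0) 0 := by
    rw [continuousWithinAt_update_same]
    rw [Set.Ici_sdiff_left]
    exact FF_zero γ v hv
  have hd : ∀ t ∈ Set.Ioi (0:ℝ), HasDerivAt (Function.update (FF γ v) 0 L)
      (v / (t * √t) * Real.exp (-(γ ^ 2 / 2) * t - v ^ 2 / (2 * t))) t := by
    intro t ht
    refine (FF_deriv γ v t ht).congr_of_eventuallyEq ?_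
    filter_upwards [isOpen_ne.mem_nhds (ne_of_gt ht)] with s hs
    exact Function.update_of_ne hs _ _
  have hpos : ∀ t ∈ Set.Ioi (0:ℝ), 0 ≤ v / (t * √t) * Real.exp (-(γ ^ 2 / 2) * t - v ^ 2 / (2 * t)) := by
    intro t ht
    have : 0 < t := ht
    positivity
  have ht : Tendsto (Function.update (FF γ v) 0 L) atTop (nhds (Real.exp (-(γ * v)) * (√(2 * Real.pi) / 2) - Real.exp (γ * v) * (√(2 * Real.pi) / 2))) := by
    refine (FF_top γ v hγ).congr' ?_
    filter_upwards [eventually_ne_atTop 0] with s hs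
    exact (Function.update_of_ne hs _ _).symm
  refine ⟨integrableOn_Ioi_deriv_of_nonneg hc hd hpos ht, ?_⟩
  rw [integral_Ioi_of_hasDerivAt_of_nonneg hc hd hpos ht, Function.update_self, hL]
  ring

lemma lin_image (γ b : ℝ) (hγ : 0 < γ) : (fun w : ℝ => γ * (w + b)) '' Set.Ioi 0 = Set.Ioi (γ * b) := by
  ext y
  simp only [Set.mem_image, Set.mem_Ioi]
  constructor
  · rintro ⟨w, hw, rfl⟩
    nlinarith [mul_pos hγ hw]
  · intro hy
    refine ⟨y / γ - b, ?_, by field_simp; ring⟩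
    rw [sub_pos, lt_div_iff₀ hγ]; linarith

lemma sq_image (c : ℝ) (hc : 0 < c) : (fun w : ℝ => (w + c) ^ 2) '' Set.Ioi 0 = Set.Ioi (c ^ 2) := by
  ext y
  simp only [Set.mem_image, Set.mem_Ioi]
  constructor
  · rintro ⟨w, hw, rfl⟩
    nlinarith [mul_pos hw hc]
  · intro hy
    have h0 : 0 ≤ y := (sq_nonneg c).trans hy.le
    refine ⟨√y - c, ?_, by rw [sub_add_cancel, Real.sq_sqrt h0]⟩
    rw [sub_pos]; exact Real.lt_sqrt_of_sq_lt hy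

lemma E1_eq (γ b : ℝ) (hγ : 0 < γ) (hb : 0 < b) :
    IntegrableOn (fun w => Real.exp (-γ * w) / (w + b)) (Set.Ioi 0) ∧
    ∫ w in Set.Ioi (0:ℝ), Real.exp (-γ * w) / (w + b) = Real.exp (γ * b) * E1 (γ * b) := by
  constructor
  · refine ((exp_neg_integrableOn_Ioi 0 hγ).div_const b).mono' ?_ ?_
    · exact (Measurable.aestronglyMeasurable (by fun_prop))
    · filter_upwards [ae_restrict_mem measurableSet_Ioi] with w hw
      have hw : 0 < w := hw
      rw [Real.norm_of_nonneg (by positivity)]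
      gcongr; linarith
  · unfold E1
    rw [← lin_image γ b hγ, integral_image_eq_integral_abs_deriv_smul (f' := fun _ => γ) measurableSet_Ioi,
      ← integral_const_mul]
    · refine setIntegral_congr_fun measurableSet_Ioi fun w hw => ?_
      have hw : 0 < w := hw
      have : -γ * w = γ * b + (-(γ * (w + b))) := by ring
      simp only [smul_eq_mul, abs_of_pos hγ]
      rw [this, Real.exp_add]
      field_simp
    · intro w _
      simpa using (((hasDerivAt_id w).add_const b).const_mul γ).hasDerivWithinAt
    · intro w _ w' _ h
      simpa [hγ.ne'] using h

lemma outer_int (a x γ : ℝ) (ha : 0 < a) (hax : a < x) (hγ : 0 < γ) :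
    IntegrableOn (fun y => Real.exp (-(γ * √y)) / (2 * √y) / ((√y - x + 3 * a) * (√y + x + a)))
      (Set.Ioi ((x - a) ^ 2)) ∧
    ∫ y in Set.Ioi ((x - a) ^ 2), Real.exp (-(γ * √y)) / (2 * √y) / ((√y - x + 3 * a) * (√y + x + a))
      = Real.exp (-(γ * (x - a))) / (2 * (x - a)) * (Real.exp (2 * γ * a) * E1 (2 * γ * a) -
            Real.exp (2 * γ * x) * E1 (2 * γ * x)) := by
  have hc : 0 < x - a := sub_pos.2 hax
  obtain ⟨i1, e1⟩ := E1_eq γ (2 * a) hγ (by linarith)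
  obtain ⟨i2, e2⟩ := E1_eq γ (2 * x) hγ (by linarith)
  have hd : ∀ w ∈ Set.Ioi (0:ℝ), HasDerivWithinAt (fun w : ℝ => (w + (x - a)) ^ 2) (2 * (w + (x - a))) (Set.Ioi 0) w := by
    intro w _
    have h := (((hasDerivAt_id w).add_const (x - a)).pow 2).hasDerivWithinAt (s := Set.Ioi 0)
    refine h.congr_deriv ?_
    simp
  have hinj : Set.InjOn (fun w : ℝ => (w + (x - a)) ^ 2) (Set.Ioi 0) := by
    intro w hw w' hw' h
    have hw : 0 < w := hw
    have hw' : 0 < w' := hw'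
    have := (sq_eq_sq₀ (by positivity) (by positivity)).1 h
    linarith
  have key : ∀ w ∈ Set.Ioi (0:ℝ), |2 * (w + (x - a))| • (Real.exp (-(γ * √((w + (x - a)) ^ 2))) / (2 * √((w + (x - a)) ^ 2)) / ((√((w + (x - a)) ^ 2) - x + 3 * a) * (√((w + (x - a)) ^ 2) + x + a)))
     = Real.exp (-(γ * (x - a))) / (2 * (x - a)) * (Real.exp (-γ * w) / (w + 2 * a) - Real.exp (-γ * w) / (w + 2 * x)) := by
    intro w hw
    have hw : 0 < w := hw
    have h1 : 0 < w + (x - a) := by linarith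
    have h3 : 0 < w + 2 * a := by linarith
    have h4 : 0 < w + 2 * x := by linarith
    rw [Real.sqrt_sq h1.le, abs_of_pos (by linarith), smul_eq_mul]
    have : -(γ * (w + (x - a))) = -(γ * (x - a)) + -γ * w := by ring
    rw [this, Real.exp_add]
    have h5 : w + (x - a) - x + 3 * a = w + 2 * a := by ring
    have h6 : w + (x - a) + x + a = w + 2 * x := by ring
    rw [h5, h6]
    field_simp
    ring
  rw [← sq_image _ hc]
  constructor
  · rw [integrableOn_image_iff_integrableOn_abs_deriv_smul measurableSet_Ioi hd hinj]
    rw [integrableOn_congr_fun key measurableSet_Ioi]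
    exact (i1.sub i2).const_mul _
  · rw [integral_image_eq_integral_abs_deriv_smul measurableSet_Ioi hd hinj,
      setIntegral_congr_fun measurableSet_Ioi key, integral_const_mul, integral_sub i1 i2, e1, e2]
    congr 4 <;> ring_nf

noncomputable def KK (γ v t : ℝ) : ℝ := v / (t * √t) * Real.exp (-(γ ^ 2 / 2) * t - v ^ 2 / (2 * t))

noncomputable def HH (a x γ t y : ℝ) : ℝ :=
  KK γ (√y) t * (1 / (2 * √y) / ((√y - x + 3 * a) * (√y + x + a)))

lemma HH_facts (a x γ : ℝ) (ha : 0 < a) (hax : a < x) (hγ : 0 < γ) :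
    IntegrableOn (fun t => ∫ y in Set.Ioi ((x - a) ^ 2), HH a x γ t y) (Set.Ioi 0) ∧
    ∫ t in Set.Ioi (0:ℝ), ∫ y in Set.Ioi ((x - a) ^ 2), HH a x γ t y =
      √(2 * Real.pi) * (Real.exp (-(γ * (x - a))) / (2 * (x - a)) *
        (Real.exp (2 * γ * a) * E1 (2 * γ * a) - Real.exp (2 * γ * x) * E1 (2 * γ * x))) := by
  have hc : 0 < x - a := sub_pos.2 hax
  obtain ⟨oi, oe⟩ := outer_int a x γ ha hax hγ
  have hy : ∀ y ∈ Set.Ioi ((x - a) ^ 2), x - a < √y := fun y hy => Real.lt_sqrt_of_sq_lt hy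
  have inner : ∀ y ∈ Set.Ioi ((x - a) ^ 2), ∫ t in Set.Ioi (0:ℝ), HH a x γ t y =
      √(2 * Real.pi) * (Real.exp (-(γ * √y)) / (2 * √y) / ((√y - x + 3 * a) * (√y + x + a))) := by
    intro y h
    have := hy y h
    unfold HH
    rw [integral_mul_const]
    unfold KK
    rw [(kernel_int γ (√y) hγ (by linarith)).2]
    ring
  have hmeas : Measurable (Function.uncurry (HH a x γ)) := by
    unfold Function.uncurry HH KK
    fun_prop
  have hint : Integrable (Function.uncurry (HH a x γ))
      ((volume.restrict (Set.Ioi (0:ℝ))).prod (volume.restrict (Set.Ioi ((x - a) ^ 2)))) := by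
    rw [integrable_prod_iff' hmeas.aestronglyMeasurable]
    constructor
    · filter_upwards [ae_restrict_mem measurableSet_Ioi] with y h
      have := hy y h
      have h0 : 0 < √y := by linarith
      exact ((kernel_int γ (√y) hγ h0).1).mul_const (1 / (2 * √y) / ((√y - x + 3 * a) * (√y + x + a)))
    · refine (integrable_congr ?_).1 (oi.const_mul (√(2 * Real.pi)))
      filter_upwards [ae_restrict_mem measurableSet_Ioi] with y h
      rw [← inner y h]
      refine setIntegral_congr_fun measurableSet_Ioi fun t ht => ?_
      have ht : 0 < t := ht
      have := hy y h
      have h1 : 0 < √y := by linarith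
      have h2 : 0 < √y - x + 3 * a := by linarith
      have h3 : 0 < √y + x + a := by linarith
      simp only [Function.uncurry]
      rw [Real.norm_of_nonneg]
      unfold HH KK
      positivity
  refine ⟨hint.integral_prod_left, ?_⟩
  rw [integral_integral_swap hint, setIntegral_congr_fun measurableSet_Ioi inner, integral_const_mul, oe]

/-- The Laplace transform of the first-order perturbed Bessel first passage time density
equals the first-order truncation f₀ + ε·f₁ of the exact Laplace transform. -/
theorem stmt_13 (a x ε β : ℝ) (ha : 0 < a) (hax : a < x) (hβ : 0 < β)
    (γ : ℝ) (hγ : γ = Real.sqrt (2 * β))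
    (p : ℝ → ℝ)
    (hp : ∀ t : ℝ, 0 < t → p t =
      (1 + (ε / 2) * Real.log (a / x)) *
          ((x - a) * (2 * Real.pi) ^ (-(1 / 2 : ℝ)) * t ^ (-(3 / 2 : ℝ)) *
            Real.exp (-(x - a) ^ 2 / (2 * t))) +
        ε * (x - a) * (2 * Real.pi * t) ^ (-(1 / 2 : ℝ)) *
          ∫ y in Set.Ioi ((x - a) ^ 2),
            (2 * t)⁻¹ * Real.exp (-y / (2 * t)) /
              ((Real.sqrt y - x + 3 * a) * (Real.sqrt y + x + a))) :
    ∫ t in Set.Ioi (0 : ℝ), Real.exp (-β * t) * p t =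
      Real.exp (-(γ * (x - a))) *
        (1 + (ε / 2) *
          (Real.log (a / x) + Real.exp (2 * γ * a) * E1 (2 * γ * a) -
            Real.exp (2 * γ * x) * E1 (2 * γ * x))) := by
  have hc : 0 < x - a := sub_pos.2 hax
  have hγ0 : 0 < γ := by rw [hγ]; positivity
  have hγ2 : γ ^ 2 / 2 = β := by rw [hγ, Real.sq_sqrt (by positivity)]; ring
  obtain ⟨hi, he⟩ := HH_facts a x γ ha hax hγ0
  obtain ⟨ki, ke⟩ := kernel_int γ (x - a) hγ0 hc
  have hpi : 0 < √(2 * Real.pi) := by positivity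
  have key : ∀ t ∈ Set.Ioi (0:ℝ), Real.exp (-β * t) * p t =
      (1 + (ε / 2) * Real.log (a / x)) / √(2 * Real.pi) * ((x - a) / (t * √t) * Real.exp (-(γ ^ 2 / 2) * t - (x - a) ^ 2 / (2 * t)))
      + ε * (x - a) / √(2 * Real.pi) * ∫ y in Set.Ioi ((x - a) ^ 2), HH a x γ t y := by
    intro t ht
    have ht : 0 < t := ht
    have hs : 0 < √t := Real.sqrt_pos.2 ht
    have r1 : (2 * Real.pi) ^ (-(1 / 2 : ℝ)) = (√(2 * Real.pi))⁻¹ := by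
      rw [Real.rpow_neg (by positivity), Real.sqrt_eq_rpow]
    have r2 : (2 * Real.pi * t) ^ (-(1 / 2 : ℝ)) = (√(2 * Real.pi))⁻¹ * (√t)⁻¹ := by
      rw [Real.rpow_neg (by positivity), ← Real.sqrt_eq_rpow, Real.sqrt_mul (by positivity), mul_inv]
    have r3 : t ^ (-(3 / 2 : ℝ)) = (t * √t)⁻¹ := by
      rw [Real.rpow_neg ht.le, Real.sqrt_eq_rpow]
      congr 1
      nth_rewrite 2 [← Real.rpow_one t]
      rw [← Real.rpow_add ht]; norm_num
    have hI : ∫ y in Set.Ioi ((x - a) ^ 2), HH a x γ t y = (Real.exp (-β * t) * (√t)⁻¹) *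
        ∫ y in Set.Ioi ((x - a) ^ 2), (2 * t)⁻¹ * Real.exp (-y / (2 * t)) /
              ((Real.sqrt y - x + 3 * a) * (Real.sqrt y + x + a)) := by
      rw [← integral_const_mul]
      refine setIntegral_congr_fun measurableSet_Ioi fun y h => ?_
      have h1 : x - a < √y := Real.lt_sqrt_of_sq_lt h
      have h0 : 0 < √y := by linarith
      have h2 : 0 < √y - x + 3 * a := by linarith
      have h3 : 0 < √y + x + a := by linarith
      have hy0 : 0 ≤ y := (sq_nonneg _).trans (le_of_lt h)
      simp only [HH, KK]
      rw [hγ2, Real.sq_sqrt hy0, sub_eq_add_neg, Real.exp_add, ← neg_div]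
      field_simp
    rw [hp t ht, r1, r2, r3, hI, hγ2, sub_eq_add_neg (-β * t), Real.exp_add, ← neg_div]
    field_simp
  rw [setIntegral_congr_fun measurableSet_Ioi key, integral_add (ki.const_mul _) (hi.const_mul _),
    integral_const_mul, integral_const_mul, ke, he]
  field_simp
  ring
end

section
/- Let w > 0, z > 0 and β > 0, and set γ = √(2β). Then ∫₀^∞ e^{−βt} · (2πt)^{−1/2} · (∫_{w²}^∞ (2t)^{−1}·e^{−y/(2t)} / (√y − w + z) dy) dt = e^{−γw} · e^{zγ} · E₁(zγ). -/
open Real Filter MeasureTheory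

open scoped Topology

lemma aux_Ioi {g g' : ℝ → ℝ} {m l : ℝ} (h0 : Tendsto g (𝓝[>] 0) (𝓝 m))
    (hderiv : ∀ x ∈ Set.Ioi (0:ℝ), HasDerivAt g (g' x) x) (g'pos : ∀ x ∈ Set.Ioi (0:ℝ), 0 ≤ g' x)
    (hg : Tendsto g atTop (𝓝 l)) :
    IntegrableOn g' (Set.Ioi 0) ∧ ∫ x in Set.Ioi 0, g' x = l - m := by
  have hc : ContinuousWithinAt (Function.update g 0 m) (Set.Ici 0) 0 := by
    rw [continuousWithinAt_update_same]
    have : Set.Ici (0:ℝ) \ {0} = Set.Ioi 0 := by simp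
    rw [this]; exact h0
  have hd : ∀ x ∈ Set.Ioi (0:ℝ), HasDerivAt (Function.update g 0 m) (g' x) x := by
    intro x hx
    refine (hderiv x hx).congr_of_eventuallyEq ?_
    filter_upwards [eventually_ne_nhds (ne_of_gt hx)] with y hy
    simp [Function.update_of_ne hy]
  have ht : Tendsto (Function.update g 0 m) atTop (𝓝 l) := by
    refine hg.congr' ?_
    filter_upwards [eventually_gt_atTop 0] with y hy
    simp [Function.update_of_ne (ne_of_gt hy)]
  refine ⟨integrableOn_Ioi_deriv_of_nonneg hc hd g'pos ht, ?_⟩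
  rw [integral_Ioi_of_hasDerivAt_of_nonneg hc hd g'pos ht]
  simp

noncomputable def auxG (x : ℝ) : ℝ := ∫ u in (0:ℝ)..x, Real.exp (-1 * u ^ 2)

lemma auxG_deriv (x : ℝ) : HasDerivAt auxG (Real.exp (-1 * x ^ 2)) x :=
  ((by fun_prop : Continuous fun u : ℝ => Real.exp (-1 * u ^ 2)).integral_hasStrictDerivAt 0 x).hasDerivAt

lemma auxG_top : Tendsto auxG atTop (𝓝 (√π / 2)) := by
  have := intervalIntegral_tendsto_integral_Ioi (μ := volume) 0
    (integrable_exp_neg_mul_sq one_pos).integrableOn tendsto_id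
  rw [integral_gaussian_Ioi] at this
  simp only [div_one] at this
  exact this

lemma auxG_neg (x : ℝ) : auxG (-x) = - auxG x := by
  unfold auxG
  have := intervalIntegral.integral_comp_neg (a := 0) (b := x) (fun u : ℝ => Real.exp (-1 * u ^ 2))
  simp only [neg_sq, neg_zero] at this
  rw [intervalIntegral.integral_symm, this]

lemma auxG_bot : Tendsto auxG atBot (𝓝 (-(√π / 2))) := by
  have := (auxG_top.comp tendsto_neg_atBot_atTop).neg
  refine this.congr fun x => ?_
  simp [auxG_neg]

lemma key (b c : ℝ) (hb : 0 < b) (hc : 0 < c) :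
    IntegrableOn (fun t => Real.exp (-(b ^ 2 * t + c ^ 2 / t)) * (c / (t * √t))) (Set.Ioi 0) ∧
    ∫ t in Set.Ioi 0, Real.exp (-(b ^ 2 * t + c ^ 2 / t)) * (c / (t * √t))
      = Real.exp (-(2 * b * c)) * √π := by
  have hs0 : Tendsto (fun t : ℝ => √t) (𝓝[>] 0) (𝓝[>] 0) := by
    refine tendsto_nhdsWithin_iff.2 ⟨?_, ?_⟩
    · have := (Real.continuous_sqrt.tendsto 0).mono_left (nhdsWithin_le_nhds (s := Set.Ioi 0))
      simpa using this
    · filter_upwards [self_mem_nhdsWithin] with t ht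
      exact Real.sqrt_pos.2 ht
  have hs0' : Tendsto (fun t : ℝ => √t) (𝓝[>] 0) (𝓝 0) := hs0.mono_right nhdsWithin_le_nhds
  have hi0 : Tendsto (fun t : ℝ => -(c / √t)) (𝓝[>] 0) atBot := by
    refine tendsto_neg_atTop_atBot.comp ?_
    simp only [div_eq_mul_inv]
    exact (tendsto_inv_nhdsGT_zero.comp hs0).const_mul_atTop hc
  have hit : Tendsto (fun t : ℝ => -(c / √t)) atTop (𝓝 0) := by
    have := (Real.tendsto_sqrt_atTop.const_div_atTop c).neg
    simpa using this
  have A (k : ℝ) : Tendsto (fun t : ℝ => k * √t + -(c / √t)) (𝓝[>] 0) atBot :=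
    (hs0'.const_mul k).add_atBot hi0
  have B1 : Tendsto (fun t : ℝ => b * √t + -(c / √t)) atTop atTop :=
    (Real.tendsto_sqrt_atTop.const_mul_atTop hb).atTop_add hit
  have B2 : Tendsto (fun t : ℝ => (-b) * √t + -(c / √t)) atTop atBot :=
    (Real.tendsto_sqrt_atTop.const_mul_atTop_of_neg (by linarith)).atBot_add hit
  have D (k t : ℝ) (ht : 0 < t) : HasDerivAt (fun t : ℝ => k * √t + -(c / √t))
      (k / (2 * √t) + c / (2 * (t * √t))) t := by
    have h1 := Real.hasDerivAt_sqrt ht.ne'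
    have h2 := (h1.const_mul k).add (((hasDerivAt_const t c).div h1 (Real.sqrt_pos.2 ht).ne').neg)
    refine h2.congr_deriv ?_
    have hs := Real.sqrt_pos.2 ht
    rw [Real.sq_sqrt ht.le]
    field_simp
    ring
  have H := aux_Ioi
    (g := fun t => Real.exp (-(2 * b * c)) * auxG (b * √t + -(c / √t)) +
        Real.exp (2 * b * c) * auxG ((-b) * √t + -(c / √t)))
    (g' := fun t => Real.exp (-(b ^ 2 * t + c ^ 2 / t)) * (c / (t * √t)))
    (((auxG_bot.comp (A b)).const_mul _).add ((auxG_bot.comp (A (-b))).const_mul _))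
    ?_ ?_
    (((auxG_top.comp B1).const_mul _).add ((auxG_bot.comp B2).const_mul _))
  · refine ⟨H.1, H.2.trans ?_⟩
    ring
  · intro t ht
    have ht : 0 < t := ht
    have h1 := ((auxG_deriv _).comp t (D b t ht)).const_mul (Real.exp (-(2 * b * c)))
    have h2 := ((auxG_deriv _).comp t (D (-b) t ht)).const_mul (Real.exp (2 * b * c))
    refine (h1.add h2).congr_deriv ?_
    have hs := Real.sqrt_pos.2 ht
    have hss := Real.sq_sqrt ht.le
    rw [← mul_assoc, ← mul_assoc (Real.exp (2 * b * c)), ← Real.exp_add, ← Real.exp_add]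
    have e1 : -(2 * b * c) + -1 * (b * √t + -(c / √t)) ^ 2 = -(b ^ 2 * t + c ^ 2 / t) := by
      have : (b * √t + -(c / √t)) ^ 2 = b ^ 2 * √t ^ 2 + c ^ 2 / √t ^ 2 - 2 * b * c := by
        field_simp; ring
      rw [this, hss]; ring
    have e2 : (2 * b * c) + -1 * ((-b) * √t + -(c / √t)) ^ 2 = -(b ^ 2 * t + c ^ 2 / t) := by
      have : ((-b) * √t + -(c / √t)) ^ 2 = b ^ 2 * √t ^ 2 + c ^ 2 / √t ^ 2 + 2 * b * c := by
        field_simp; ring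
      rw [this, hss]; ring
    rw [e1, e2]
    field_simp
    ring
  · intro t ht
    have ht : 0 < t := ht
    positivity

lemma key2 (β y : ℝ) (hβ : 0 < β) (hy : 0 < y) :
    IntegrableOn (fun t => Real.exp (-β * t) * ((2 * π * t) ^ (-(1 / 2 : ℝ)) *
      ((2 * t)⁻¹ * Real.exp (-y / (2 * t))))) (Set.Ioi 0) ∧
    ∫ t in Set.Ioi 0, Real.exp (-β * t) * ((2 * π * t) ^ (-(1 / 2 : ℝ)) *
      ((2 * t)⁻¹ * Real.exp (-y / (2 * t)))) = Real.exp (-(√(2 * β) * √y)) / (2 * √y) := by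
  have hsy := Real.sqrt_pos.2 hy
  have h2 : 0 < √(2:ℝ) := by positivity
  have hpi : 0 < √π := Real.sqrt_pos.2 pi_pos
  obtain ⟨h1, h3⟩ := key (√β) (√y / √2) (Real.sqrt_pos.2 hβ) (by positivity)
  have E : Set.EqOn (fun t => (1 / (2 * √y * √π)) * (Real.exp (-(√β ^ 2 * t + (√y / √2) ^ 2 / t)) *
      (√y / √2 / (t * √t)))) (fun t => Real.exp (-β * t) * ((2 * π * t) ^ (-(1 / 2 : ℝ)) *
      ((2 * t)⁻¹ * Real.exp (-y / (2 * t))))) (Set.Ioi 0) := by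
    intro t ht
    have ht : 0 < t := ht
    have hst := Real.sqrt_pos.2 ht
    dsimp only
    rw [Real.rpow_neg (by positivity), ← Real.sqrt_eq_rpow, Real.sqrt_mul (by positivity),
      Real.sqrt_mul (by positivity), div_pow, Real.sq_sqrt hβ.le, Real.sq_sqrt hy.le,
      Real.sq_sqrt (by positivity)]
    have : Real.exp (-(β * t + y / 2 / t)) = Real.exp (-β * t) * Real.exp (-y / (2 * t)) := by
      rw [← Real.exp_add]; congr 1; field_simp; ring
    rw [this]
    field_simp
  refine ⟨(integrableOn_congr_fun E measurableSet_Ioi).1 (h1.const_mul _), ?_⟩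
  rw [← setIntegral_congr_fun measurableSet_Ioi E, integral_const_mul, h3,
    Real.sqrt_mul (by positivity)]
  have : 2 * √β * (√y / √2) = √2 * √β * √y := by
    have := Real.sq_sqrt (show (0:ℝ) ≤ 2 by norm_num)
    field_simp
    rw [this]
  rw [this]
  field_simp

lemma key3 (w z γ : ℝ) (hw : 0 < w) (hz : 0 < z) (hγ : 0 < γ) :
    IntegrableOn (fun y => Real.exp (-(γ * √y)) / (2 * √y) / (√y - w + z)) (Set.Ioi (w ^ 2)) ∧
    ∫ y in Set.Ioi (w ^ 2), Real.exp (-(γ * √y)) / (2 * √y) / (√y - w + z) =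
      Real.exp (-(γ * w)) * Real.exp (z * γ) * E1 (z * γ) := by
  have hlt : ∀ y ∈ Set.Ioi (w ^ 2), w < √y := fun y hy => (Real.lt_sqrt hw.le).2 hy
  have hder : ∀ y ∈ Set.Ioi (w ^ 2), HasDerivWithinAt (fun y => γ * (√y - w + z))
      (γ * (1 / (2 * √y))) (Set.Ioi (w ^ 2)) y := by
    intro y hy
    have h0 : 0 < y := lt_trans (by positivity) hy
    exact ((((Real.hasDerivAt_sqrt h0.ne').sub_const w).add_const z).const_mul γ).hasDerivWithinAt
  have hinj : Set.InjOn (fun y => γ * (√y - w + z)) (Set.Ioi (w ^ 2)) := by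
    intro a ha b hb hab
    have ha0 : 0 < a := lt_trans (by positivity) ha
    have hb0 : 0 < b := lt_trans (by positivity) hb
    have h1 := mul_left_cancel₀ hγ.ne' hab
    exact (Real.sqrt_inj ha0.le hb0.le).1 (by linarith)
  have himg : (fun y => γ * (√y - w + z)) '' (Set.Ioi (w ^ 2)) = Set.Ioi (z * γ) := by
    ext u
    constructor
    · rintro ⟨y, hy, rfl⟩
      have := hlt y hy
      simp only [Set.mem_Ioi]
      nlinarith
    · intro hu
      have hu : z * γ < u := hu
      have h1 : z < u / γ := (lt_div_iff₀ hγ).2 hu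
      refine ⟨(u / γ + w - z) ^ 2, ?_, ?_⟩
      · simp only [Set.mem_Ioi]
        nlinarith
      · dsimp only
        rw [Real.sqrt_sq (by linarith)]
        field_simp
        ring
  have hE : IntegrableOn (fun u => Real.exp (-u) / u) (Set.Ioi (z * γ)) := by
    have hp : 0 < z * γ := by positivity
    refine Integrable.mono' ((integrableOn_exp_neg_Ioi (z * γ)).div_const (z * γ))
      (by
        apply Measurable.aestronglyMeasurable
        exact (Real.measurable_exp.comp measurable_neg).div measurable_id) ?_
    refine (ae_restrict_iff' measurableSet_Ioi).2 (Eventually.of_forall fun u hu => ?_)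
    have hu : z * γ < u := hu
    have : 0 < u := hp.trans hu
    rw [Real.norm_of_nonneg (by positivity)]
    gcongr
  have E : Set.EqOn (fun y => (Real.exp (-(γ * w)) * Real.exp (z * γ)) *
      (|γ * (1 / (2 * √y))| • (Real.exp (-(γ * (√y - w + z))) / (γ * (√y - w + z)))))
      (fun y => Real.exp (-(γ * √y)) / (2 * √y) / (√y - w + z)) (Set.Ioi (w ^ 2)) := by
    intro y hy
    have h1 := hlt y hy
    have h2 : 0 < √y := hw.trans h1
    have h3 : 0 < √y - w + z := by linarith
    dsimp only
    rw [abs_of_pos (by positivity), smul_eq_mul]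
    have : Real.exp (-(γ * √y)) =
        Real.exp (-(γ * w)) * Real.exp (z * γ) * Real.exp (-(γ * (√y - w + z))) := by
      rw [← Real.exp_add, ← Real.exp_add]; congr 1; ring
    rw [this]
    field_simp
  have hI := integrableOn_image_iff_integrableOn_abs_deriv_smul measurableSet_Ioi hder hinj
    (fun u => Real.exp (-u) / u)
  have hJ := integral_image_eq_integral_abs_deriv_smul measurableSet_Ioi hder hinj
    (fun u => Real.exp (-u) / u)
  rw [himg] at hI hJ
  refine ⟨(integrableOn_congr_fun E measurableSet_Ioi).1 ((hI.1 hE).const_mul _), ?_⟩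
  rw [← setIntegral_congr_fun measurableSet_Ioi E, integral_const_mul, E1, hJ]

/-- Laplace inversion identity: for w, z, β > 0 and γ = √(2β),
∫₀^∞ e^{−βt} (2πt)^{−1/2} (∫_{w²}^∞ (2t)^{−1} e^{−y/(2t)} / (√y − w + z) dy) dt
  = e^{−γw}·e^{zγ}·E₁(zγ). -/
theorem stmt_14 (w z β : ℝ) (hw : 0 < w) (hz : 0 < z) (hβ : 0 < β)
    (γ : ℝ) (hγ : γ = Real.sqrt (2 * β)) :
    ∫ t in Set.Ioi (0 : ℝ),
        Real.exp (-β * t) * ((2 * Real.pi * t) ^ (-(1 / 2 : ℝ)) *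
          ∫ y in Set.Ioi (w ^ 2),
            (2 * t)⁻¹ * Real.exp (-y / (2 * t)) / (Real.sqrt y - w + z)) =
      Real.exp (-(γ * w)) * Real.exp (z * γ) * E1 (z * γ) := by
  have hγ0 : 0 < γ := by rw [hγ]; positivity
  obtain ⟨h3, h4⟩ := key3 w z γ hw hz hγ0
  have hy0 : ∀ y ∈ Set.Ioi (w ^ 2), 0 < y := fun y hy => lt_trans (by positivity) hy
  have hden : ∀ y ∈ Set.Ioi (w ^ 2), 0 < √y - w + z := fun y hy => by
    have := (Real.lt_sqrt hw.le).2 hy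
    linarith
  have hin : ∀ y ∈ Set.Ioi (w ^ 2), ∫ t in Set.Ioi (0:ℝ), (Real.exp (-β * t) *
      ((2 * π * t) ^ (-(1 / 2 : ℝ)) * ((2 * t)⁻¹ * Real.exp (-y / (2 * t))))) / (√y - w + z)
      = Real.exp (-(γ * √y)) / (2 * √y) / (√y - w + z) := by
    intro y hy
    rw [integral_div, (key2 β y hβ (hy0 y hy)).2, hγ]
  have hint : Integrable (Function.uncurry fun t y => (Real.exp (-β * t) *
      ((2 * π * t) ^ (-(1 / 2 : ℝ)) * ((2 * t)⁻¹ * Real.exp (-y / (2 * t))))) / (√y - w + z))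
      ((volume.restrict (Set.Ioi (0:ℝ))).prod (volume.restrict (Set.Ioi (w ^ 2)))) := by
    rw [integrable_prod_iff' (by
      apply Measurable.aestronglyMeasurable
      unfold Function.uncurry
      fun_prop)]
    constructor
    · refine (ae_restrict_iff' measurableSet_Ioi).2 (Eventually.of_forall fun y hy => ?_)
      exact (key2 β y hβ (hy0 y hy)).1.div_const (√y - w + z)
    · refine (integrableOn_congr_fun ?_ measurableSet_Ioi).1 h3
      intro y hy
      dsimp only
      rw [← hin y hy]
      refine setIntegral_congr_fun measurableSet_Ioi fun t ht => ?_
      have ht : 0 < t := ht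
      have := hden y hy
      simp only [Function.uncurry]
      rw [Real.norm_of_nonneg (by positivity)]
  rw [← h4, ← setIntegral_congr_fun measurableSet_Ioi hin, ← integral_integral_swap hint]
  refine integral_congr_ae (Eventually.of_forall fun t => ?_)
  dsimp only
  rw [← integral_const_mul, ← integral_const_mul]
  refine integral_congr_ae (Eventually.of_forall fun y => ?_)
  dsimp only
  ring
end

section
/- Let 0 < a < x and ε ∈ ℝ. Define p(t) = (1 + (ε/2)·ln(a/x)) · (x−a)·(2π)^{−1/2}·t^{−3/2}·e^{−(x−a)²/(2t)} + ε·(x−a)·(2πt)^{−1/2} · ∫_{(x−a)²}^∞ (2t)^{−1}·e^{−y/(2t)} / ((√y − x + 3a)·(√y + x + a)) dy for t > 0. Then ∫₀^∞ p(t) dt = 1. -/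
open Real Filter MeasureTheory

lemma aux_int_s15 (c : ℝ) (hc : 0 < c) :
    ∫ t in Set.Ioi (0 : ℝ), t ^ (-(3 / 2 : ℝ)) * Real.exp (-c / (2 * t))
      = Real.sqrt (2 * Real.pi) * (Real.sqrt c)⁻¹ := by
  have h := integral_comp_rpow_Ioi
    (fun t : ℝ => t ^ (-(3 / 2 : ℝ)) * Real.exp (-c / (2 * t))) (p := -1) (by norm_num)
  rw [← h]
  have h2 := Real.integral_rpow_mul_exp_neg_mul_Ioi (a := 1 / 2) (r := c / 2)
    (by norm_num) (by positivity)
  rw [Real.Gamma_one_half_eq, ← Real.sqrt_eq_rpow] at h2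
  have h3 : √(1 / (c / 2)) * √Real.pi = Real.sqrt (2 * Real.pi) * (Real.sqrt c)⁻¹ := by
    rw [← Real.sqrt_mul (by positivity), ← Real.sqrt_inv, ← Real.sqrt_mul (by positivity)]
    congr 1
    field_simp
  rw [← h3, ← h2]
  refine setIntegral_congr_fun measurableSet_Ioi fun s hs => ?_
  have hs : 0 < s := hs
  simp only [smul_eq_mul]
  rw [← Real.rpow_mul hs.le]
  have e1 : -c / (2 * s ^ (-1 : ℝ)) = -(c / 2 * s) := by
    rw [Real.rpow_neg_one]; field_simp
  rw [e1, ← mul_assoc, mul_assoc |(-1 : ℝ)|, ← Real.rpow_add hs]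
  norm_num

lemma aux_integrable (c : ℝ) (hc : 0 < c) :
    IntegrableOn (fun t : ℝ => t ^ (-(3 / 2 : ℝ)) * Real.exp (-c / (2 * t))) (Set.Ioi 0) := by
  apply Integrable.of_integral_ne_zero
  rw [aux_int_s15 c hc]
  have := Real.pi_pos
  positivity

lemma aux_y (a x : ℝ) (ha : 0 < a) (hax : a < x) :
    IntegrableOn (fun y : ℝ => (Real.sqrt y)⁻¹ *
      ((Real.sqrt y - x + 3 * a) * (Real.sqrt y + x + a))⁻¹) (Set.Ioi ((x - a) ^ 2)) ∧
    ∫ y in Set.Ioi ((x - a) ^ 2), (Real.sqrt y)⁻¹ *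
      ((Real.sqrt y - x + 3 * a) * (Real.sqrt y + x + a))⁻¹
      = - ((x - a)⁻¹ * Real.log (a / x)) := by
  have hb : 0 < x - a := by linarith
  have hsq : Real.sqrt ((x - a) ^ 2) = x - a := Real.sqrt_sq hb.le
  have hge : ∀ y ∈ Set.Ici ((x - a) ^ 2), x - a ≤ Real.sqrt y := fun y hy => by
    rw [← hsq]; exact Real.sqrt_le_sqrt hy
  have hd : ∀ y ∈ Set.Ici ((x - a) ^ 2), HasDerivAt
      (fun y => (x - a)⁻¹ * (Real.log (Real.sqrt y - x + 3 * a) - Real.log (Real.sqrt y + x + a)))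
      ((Real.sqrt y)⁻¹ * ((Real.sqrt y - x + 3 * a) * (Real.sqrt y + x + a))⁻¹) y := by
    intro y hy
    have h1 := hge y hy
    have hs0 : 0 < Real.sqrt y := by linarith
    have hy0 : 0 < y := Real.sqrt_pos.1 hs0
    have p1 : 0 < Real.sqrt y - x + 3 * a := by linarith
    have p2 : 0 < Real.sqrt y + x + a := by linarith
    have hs := Real.hasDerivAt_sqrt hy0.ne'
    have d1 := ((hs.sub_const x).add_const (3 * a)).log p1.ne'
    have d2 := ((hs.add_const x).add_const a).log p2.ne'
    refine ((d1.sub d2).const_mul (x - a)⁻¹).congr_deriv ?_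
    have := hb.ne'
    have q1 := p1.ne'
    have q2 := p2.ne'
    have q3 := hs0.ne'
    generalize hu : Real.sqrt y - x + 3 * a = u at *
    have hv : Real.sqrt y + x + a = u + 2 * (x - a) := by rw [← hu]; ring
    rw [hv] at q2 ⊢
    field_simp
    ring
  have hnn : ∀ y ∈ Set.Ioi ((x - a) ^ 2), 0 ≤ (Real.sqrt y)⁻¹ *
      ((Real.sqrt y - x + 3 * a) * (Real.sqrt y + x + a))⁻¹ := by
    intro y hy
    have h1 := hge y (Set.mem_Ici.2 (le_of_lt hy))
    have p1 : 0 < Real.sqrt y - x + 3 * a := by linarith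
    have p2 : 0 < Real.sqrt y + x + a := by linarith
    positivity
  have hlim : Tendsto (fun y => (x - a)⁻¹ * (Real.log (Real.sqrt y - x + 3 * a)
      - Real.log (Real.sqrt y + x + a))) atTop (nhds 0) := by
    have hq : Tendsto (fun y : ℝ => Real.sqrt y + x + a) atTop atTop :=
      tendsto_atTop_add_const_right _ _ (tendsto_atTop_add_const_right _ _ Real.tendsto_sqrt_atTop)
    have hr : Tendsto (fun y : ℝ => 1 - (2 * (x - a)) * (Real.sqrt y + x + a)⁻¹) atTop
        (nhds (1 - (2 * (x - a)) * 0)) :=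
      tendsto_const_nhds.sub ((tendsto_inv_atTop_zero.comp hq).const_mul _)
    rw [mul_zero, sub_zero] at hr
    have hl := (((Real.continuousAt_log one_ne_zero).tendsto.comp hr).const_mul (x - a)⁻¹)
    rw [Real.log_one, mul_zero] at hl
    refine hl.congr' ?_
    filter_upwards [eventually_ge_atTop ((x - a) ^ 2)] with y hy
    have h1 := hge y hy
    have p1 : 0 < Real.sqrt y - x + 3 * a := by linarith
    have p2 : 0 < Real.sqrt y + x + a := by linarith
    rw [← Real.log_div p1.ne' p2.ne']
    simp only [Function.comp]
    congr 2
    field_simp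
    ring
  refine ⟨integrableOn_Ioi_deriv_of_nonneg' hd hnn hlim, ?_⟩
  rw [integral_Ioi_of_hasDerivAt_of_nonneg' hd hnn hlim, hsq]
  have e : Real.log (x - a - x + 3 * a) - Real.log (x - a + x + a) = Real.log (a / x) := by
    rw [← Real.log_div (by linarith) (by linarith)]
    congr 1
    have : x ≠ 0 := by linarith
    have h2 : x - a + x + a = 2 * x := by ring
    rw [h2]
    field_simp
    ring
  rw [e]; ring

lemma aux_prod (a x : ℝ) (ha : 0 < a) (hax : a < x) :
    Integrable (Function.uncurry fun t y : ℝ => t ^ (-(3 / 2 : ℝ)) * Real.exp (-y / (2 * t)) *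
      ((Real.sqrt y - x + 3 * a) * (Real.sqrt y + x + a))⁻¹)
      ((volume.restrict (Set.Ioi (0 : ℝ))).prod (volume.restrict (Set.Ioi ((x - a) ^ 2)))) := by
  have hb : 0 < x - a := by linarith
  have hm : Measurable (Function.uncurry fun t y : ℝ =>
      t ^ (-(3 / 2 : ℝ)) * Real.exp (-y / (2 * t)) *
      ((Real.sqrt y - x + 3 * a) * (Real.sqrt y + x + a))⁻¹) := by
    unfold Function.uncurry
    fun_prop
  rw [integrable_prod_iff' hm.aestronglyMeasurable]
  constructor
  · filter_upwards [ae_restrict_mem measurableSet_Ioi] with y hy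
    have hy0 : 0 < y := lt_trans (by positivity) hy
    simp only [Function.uncurry]
    exact (aux_integrable y hy0).mul_const _
  · refine ((aux_y a x ha hax).1.const_mul (Real.sqrt (2 * Real.pi))).congr ?_
    filter_upwards [ae_restrict_mem measurableSet_Ioi] with y hy
    have hy0 : 0 < y := lt_trans (by positivity) hy
    have h1 : x - a ≤ Real.sqrt y := by
      rw [← Real.sqrt_sq hb.le]; exact Real.sqrt_le_sqrt (le_of_lt hy)
    have p1 : 0 < Real.sqrt y - x + 3 * a := by linarith
    have p2 : 0 < Real.sqrt y + x + a := by linarith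
    rw [← mul_assoc, ← aux_int_s15 y hy0, ← integral_mul_const]
    refine setIntegral_congr_fun measurableSet_Ioi fun t ht => ?_
    have ht : 0 < t := ht
    simp only [Function.uncurry]
    rw [Real.norm_of_nonneg (by positivity)]

/-- Full integrability (total mass one) of the first-order perturbed first passage time
density of the Bessel process BES(1+ε) started at x hitting level a from above. -/
theorem stmt_15 (a x ε : ℝ) (ha : 0 < a) (hax : a < x)
    (p : ℝ → ℝ)
    (hp : ∀ t : ℝ, 0 < t → p t =
      (1 + (ε / 2) * Real.log (a / x)) *
          ((x - a) * (2 * Real.pi) ^ (-(1 / 2 : ℝ)) * t ^ (-(3 / 2 : ℝ)) *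
            Real.exp (-(x - a) ^ 2 / (2 * t))) +
        ε * (x - a) * (2 * Real.pi * t) ^ (-(1 / 2 : ℝ)) *
          ∫ y in Set.Ioi ((x - a) ^ 2),
            (2 * t)⁻¹ * Real.exp (-y / (2 * t)) /
              ((Real.sqrt y - x + 3 * a) * (Real.sqrt y + x + a))) :
    ∫ t in Set.Ioi (0 : ℝ), p t = 1 := by
  have hb : 0 < x - a := by linarith
  have hpi := Real.pi_pos
  have hP := aux_prod a x ha hax
  have hK : (2 * Real.pi) ^ (-(1 / 2 : ℝ)) = (Real.sqrt (2 * Real.pi))⁻¹ := by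
    rw [Real.rpow_neg (by positivity), ← Real.sqrt_eq_rpow]
  set K := Real.sqrt (2 * Real.pi) with hKdef
  have hK0 : 0 < K := by positivity
  have hcongr : ∀ t ∈ Set.Ioi (0 : ℝ), p t =
      (1 + (ε / 2) * Real.log (a / x)) * (x - a) * K⁻¹ *
        (t ^ (-(3 / 2 : ℝ)) * Real.exp (-((x - a) ^ 2) / (2 * t))) +
      (ε * (x - a) * K⁻¹ / 2) * ∫ y in Set.Ioi ((x - a) ^ 2),
        t ^ (-(3 / 2 : ℝ)) * Real.exp (-y / (2 * t)) *
          ((Real.sqrt y - x + 3 * a) * (Real.sqrt y + x + a))⁻¹ := by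
    intro t ht
    have ht : 0 < t := ht
    rw [hp t ht, hK, Real.mul_rpow (by positivity) ht.le, hK]
    congr 1
    · ring
    · rw [← integral_const_mul, ← integral_const_mul]
      congr 1
      ext y
      have e : t ^ (-(3 / 2 : ℝ)) = t ^ (-(1 / 2 : ℝ)) * t⁻¹ := by
        rw [← Real.rpow_neg_one t, ← Real.rpow_add ht]; norm_num
      rw [e, mul_inv 2 t, div_eq_mul_inv]
      ring
  rw [setIntegral_congr_fun measurableSet_Ioi hcongr]
  have hI := hP.integral_prod_left
  simp only [Function.uncurry] at hI
  rw [integral_add ((aux_integrable _ (by positivity)).const_mul _) (hI.const_mul _),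
    integral_const_mul, integral_const_mul, aux_int_s15 _ (by positivity), Real.sqrt_sq hb.le,
    integral_integral_swap hP]
  have hin : ∫ y in Set.Ioi ((x - a) ^ 2), ∫ t in Set.Ioi (0 : ℝ),
      t ^ (-(3 / 2 : ℝ)) * Real.exp (-y / (2 * t)) *
          ((Real.sqrt y - x + 3 * a) * (Real.sqrt y + x + a))⁻¹
      = K * -((x - a)⁻¹ * Real.log (a / x)) := by
    rw [← (aux_y a x ha hax).2, ← integral_const_mul]
    refine setIntegral_congr_fun measurableSet_Ioi fun y hy => ?_
    have hy0 : 0 < y := lt_trans (by positivity) hy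
    rw [integral_mul_const, aux_int_s15 y hy0, mul_assoc]
  rw [hin, ← hKdef]
  field_simp
  ring
end

section
/- Let 0 < a < x and ε ∈ ℝ. Define p(t) as the first-order perturbed Bessel density p(t) = (1 + (ε/2)·ln(a/x)) · p⁰(t) + ε·(x−a)·(2πt)^{−1/2} · ∫_{(x−a)²}^∞ (2t)^{−1}·e^{−y/(2t)} / ((√y − x + 3a)·(√y + x + a)) dy, where p⁰(t) = (x−a)·(2π)^{−1/2}·t^{−3/2}·e^{−(x−a)²/(2t)}. Then lim_{t→0⁺} p(t)/p⁰(t) = 1 + (ε/2)·ln(a/x). -/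
open Real Filter MeasureTheory

lemma aux_bound (a x t : ℝ) (ha : 0 < a) (hax : a < x) (ht : 0 < t) :
    |∫ y in Set.Ioi ((x - a) ^ 2),
            (2 * t)⁻¹ * Real.exp (-y / (2 * t)) /
              ((Real.sqrt y - x + 3 * a) * (Real.sqrt y + x + a))|
      ≤ (4 * a * x)⁻¹ * Real.exp (-(x - a) ^ 2 / (2 * t)) := by
  have hn : -(2 * t)⁻¹ < 0 := by
    have : 0 < (2 * t)⁻¹ := by positivity
    linarith
  have hx : 0 < x := ha.trans hax
  have hint := (integrableOn_exp_mul_Ioi hn ((x - a) ^ 2)).const_mul ((4 * a * x)⁻¹ * (2 * t)⁻¹)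
  have h := norm_integral_le_of_norm_le (μ := volume.restrict (Set.Ioi ((x - a) ^ 2)))
    (f := fun y => (2 * t)⁻¹ * Real.exp (-y / (2 * t)) /
              ((Real.sqrt y - x + 3 * a) * (Real.sqrt y + x + a))) hint ?_
  · rw [integral_const_mul, integral_exp_mul_Ioi hn] at h
    refine h.trans (le_of_eq ?_)
    have e : -(2 * t)⁻¹ * (x - a) ^ 2 = -(x - a) ^ 2 / (2 * t) := by
      field_simp
    rw [e]
    field_simp
  · refine (ae_restrict_iff' measurableSet_Ioi).2 (Eventually.of_forall fun y hy => ?_)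
    have hs : x - a < Real.sqrt y := Real.lt_sqrt_of_sq_lt hy
    have h1 : 2 * a ≤ Real.sqrt y - x + 3 * a := by linarith
    have h2 : 2 * x ≤ Real.sqrt y + x + a := by linarith
    have hD : 4 * a * x ≤ (Real.sqrt y - x + 3 * a) * (Real.sqrt y + x + a) := by
      calc 4 * a * x = (2 * a) * (2 * x) := by ring
        _ ≤ _ := mul_le_mul h1 h2 (by positivity) (by linarith)
    have hp : 0 < 4 * a * x := by positivity
    have hD0 := hp.trans_le hD
    have e : -(2 * t)⁻¹ * y = -y / (2 * t) := by
      field_simp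
    rw [e, Real.norm_eq_abs, abs_of_nonneg (by positivity), div_eq_inv_mul, ← mul_assoc]
    gcongr

/-- Left-tail asymptotic of the first-order perturbed Bessel first passage time density:
p(t)/p⁰(t) → 1 + (ε/2)·ln(a/x) as t → 0⁺. -/
theorem stmt_16 (a x ε : ℝ) (ha : 0 < a) (hax : a < x)
    (p p0 : ℝ → ℝ)
    (hp0 : ∀ t : ℝ, 0 < t → p0 t =
      (x - a) * (2 * Real.pi) ^ (-(1 / 2 : ℝ)) * t ^ (-(3 / 2 : ℝ)) *
        Real.exp (-(x - a) ^ 2 / (2 * t)))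
    (hp : ∀ t : ℝ, 0 < t → p t =
      (1 + (ε / 2) * Real.log (a / x)) * p0 t +
        ε * (x - a) * (2 * Real.pi * t) ^ (-(1 / 2 : ℝ)) *
          ∫ y in Set.Ioi ((x - a) ^ 2),
            (2 * t)⁻¹ * Real.exp (-y / (2 * t)) /
              ((Real.sqrt y - x + 3 * a) * (Real.sqrt y + x + a))) :
    Tendsto (fun t => p t / p0 t) (nhdsWithin 0 (Set.Ioi 0))
      (nhds (1 + (ε / 2) * Real.log (a / x))) := by
  have hd : 0 < x - a := sub_pos.2 hax
  have hx : 0 < x := ha.trans hax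
  have key : Tendsto (fun t => p t / p0 t - (1 + (ε / 2) * Real.log (a / x)))
      (nhdsWithin 0 (Set.Ioi 0)) (nhds 0) := by
    have hlim : Tendsto (fun t : ℝ => |ε| * (4 * a * x)⁻¹ * t)
        (nhdsWithin 0 (Set.Ioi 0)) (nhds 0) := by
      have : Tendsto (fun t : ℝ => |ε| * (4 * a * x)⁻¹ * t) (nhds 0)
          (nhds (|ε| * (4 * a * x)⁻¹ * 0)) := tendsto_id.const_mul _
      rw [mul_zero] at this
      exact this.mono_left nhdsWithin_le_nhds
    refine squeeze_zero_norm' ?_ hlim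
    filter_upwards [self_mem_nhdsWithin] with t ht
    have ht : 0 < t := ht
    have hb := aux_bound a x t ha hax ht
    rw [hp t ht]
    generalize (∫ y in Set.Ioi ((x - a) ^ 2),
            (2 * t)⁻¹ * Real.exp (-y / (2 * t)) /
              ((Real.sqrt y - x + 3 * a) * (Real.sqrt y + x + a))) = I at hb ⊢
    have hA : 0 < (2 * Real.pi) ^ (-(1 / 2 : ℝ)) := by positivity
    have hB : 0 < t ^ (-(3 / 2 : ℝ)) := by positivity
    have hE : 0 < Real.exp (-(x - a) ^ 2 / (2 * t)) := Real.exp_pos _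
    have e1 : (2 * Real.pi * t) ^ (-(1 / 2 : ℝ))
        = (2 * Real.pi) ^ (-(1 / 2 : ℝ)) * (t ^ (-(3 / 2 : ℝ)) * t) := by
      rw [Real.mul_rpow (by positivity) ht.le, ← Real.rpow_add_one ht.ne']
      norm_num
    have h0 := hp0 t ht
    have hpos : 0 < p0 t := by rw [h0]; positivity
    rw [add_div, mul_div_assoc, div_self hpos.ne', mul_one, add_sub_cancel_left, h0, e1]
    generalize (2 * Real.pi) ^ (-(1 / 2 : ℝ)) = A at *
    generalize t ^ (-(3 / 2 : ℝ)) = B at *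
    generalize Real.exp (-(x - a) ^ 2 / (2 * t)) = E at *
    have e2 : ε * (x - a) * (A * (B * t)) * I / ((x - a) * A * B * E) = ε * t * (I / E) := by
      field_simp
    rw [e2, Real.norm_eq_abs, abs_mul, abs_mul, abs_of_pos ht, abs_div, abs_of_pos hE]
    have : |I| / E ≤ (4 * a * x)⁻¹ := by rwa [div_le_iff₀ hE]
    calc |ε| * t * (|I| / E) ≤ |ε| * t * (4 * a * x)⁻¹ := by gcongr
      _ = _ := by ring
  have := key.add_const (1 + (ε / 2) * Real.log (a / x))
  simpa using this
end

section
/- Let 0 < a < x and ε > 0. Define p(t) = (1 + (ε/2)·ln(a/x)) · (x−a)·(2π)^{−1/2}·t^{−3/2}·e^{−(x−a)²/(2t)} + ε·(x−a)·(2πt)^{−1/2} · ∫_{(x−a)²}^∞ (2t)^{−1}·e^{−y/(2t)} / ((√y − x + 3a)·(√y + x + a)) dy for t > 0. Then lim_{t→∞} p(t) = 0 while lim_{t→∞} t^{3/2}·p(t) = +∞. -/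
open Real Filter MeasureTheory

lemma aux_integral (a x : ℝ) (ha : 0 < a) (hax : a < x) :
    ∃ B c : ℝ, 0 < c ∧ ∀ t : ℝ, 1 ≤ t →
      0 ≤ (∫ y in Set.Ioi ((x - a) ^ 2),
            (2 * t)⁻¹ * Real.exp (-y / (2 * t)) /
              ((Real.sqrt y - x + 3 * a) * (Real.sqrt y + x + a))) ∧
      (∫ y in Set.Ioi ((x - a) ^ 2),
            (2 * t)⁻¹ * Real.exp (-y / (2 * t)) /
              ((Real.sqrt y - x + 3 * a) * (Real.sqrt y + x + a))) ≤ B ∧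
      c * Real.log t ≤ t * (∫ y in Set.Ioi ((x - a) ^ 2),
            (2 * t)⁻¹ * Real.exp (-y / (2 * t)) /
              ((Real.sqrt y - x + 3 * a) * (Real.sqrt y + x + a))) := by
  obtain ⟨d, hd⟩ : ∃ d, d = x - a := ⟨_, rfl⟩
  have hd0 : 0 < d := by linarith
  rw [← hd]
  set K : ℝ := (1 + 3 * a / d) * (1 + (x + a) / d) with hK
  have hx : 0 < x := by linarith
  have hK0 : 0 < K := by positivity
  refine ⟨(4 * a * x)⁻¹, Real.exp (-d ^ 2 / 2) / (2 * K), by positivity, ?_⟩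
  intro t ht
  have ht0 : 0 < t := by linarith
  have hm0 : 0 < d ^ 2 := by positivity
  have hs : ∀ y ∈ Set.Ioi (d ^ 2), d < Real.sqrt y := fun y hy =>
    (Real.lt_sqrt hd0.le).2 hy
  have hden : ∀ y ∈ Set.Ioi (d ^ 2),
      4 * a * x ≤ (Real.sqrt y - x + 3 * a) * (Real.sqrt y + x + a) := by
    intro y hy
    have := hs y hy
    have h1 : 2 * a ≤ Real.sqrt y - x + 3 * a := by linarith
    have h2 : 2 * x ≤ Real.sqrt y + x + a := by linarith
    calc 4 * a * x = (2 * a) * (2 * x) := by ring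
      _ ≤ _ := mul_le_mul h1 h2 (by positivity) (by linarith)
  have hden2 : ∀ y ∈ Set.Ioi (d ^ 2),
      (Real.sqrt y - x + 3 * a) * (Real.sqrt y + x + a) ≤ K * y := by
    intro y hy
    have h := hs y hy
    have hy0 : 0 < y := hm0.trans hy
    have h1 : Real.sqrt y - x + 3 * a ≤ Real.sqrt y * (1 + 3 * a / d) := by
      have : 3 * a / d * d ≤ 3 * a / d * Real.sqrt y := by gcongr
      rw [div_mul_cancel₀ _ hd0.ne'] at this
      nlinarith
    have h2 : Real.sqrt y + x + a ≤ Real.sqrt y * (1 + (x + a) / d) := by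
      have : (x + a) / d * d ≤ (x + a) / d * Real.sqrt y := by gcongr
      rw [div_mul_cancel₀ _ hd0.ne'] at this
      nlinarith
    calc _ ≤ (Real.sqrt y * (1 + 3 * a / d)) * (Real.sqrt y * (1 + (x + a) / d)) :=
          mul_le_mul h1 h2 (by linarith) (by positivity)
      _ = K * (Real.sqrt y * Real.sqrt y) := by rw [hK]; ring
      _ = K * y := by rw [Real.mul_self_sqrt hy0.le]
  set g : ℝ → ℝ := fun y => (2 * t)⁻¹ * Real.exp (-y / (2 * t)) /
              ((Real.sqrt y - x + 3 * a) * (Real.sqrt y + x + a)) with hg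
  have h4 : 0 < 4 * a * x := by positivity
  have hg0 : ∀ y ∈ Set.Ioi (d ^ 2), 0 ≤ g y := by
    intro y hy
    have := h4.trans_le (hden y hy)
    simp only [hg]
    positivity
  set f : ℝ → ℝ := fun y => (4 * a * x)⁻¹ * (2 * t)⁻¹ * Real.exp ((-(2 * t)⁻¹) * y) with hf
  have hgf : ∀ y ∈ Set.Ioi (d ^ 2), g y ≤ f y := by
    intro y hy
    have h1 := hden y hy
    have : f y = (2 * t)⁻¹ * Real.exp (-y / (2 * t)) / (4 * a * x) := by
      simp only [hf]
      rw [show -(2 * t)⁻¹ * y = -y / (2 * t) by ring]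
      ring
    rw [this]
    simp only [hg]
    gcongr
  have hneg : -(2 * t)⁻¹ < 0 := by
    have : 0 < (2 * t)⁻¹ := by positivity
    linarith
  have hfi : IntegrableOn f (Set.Ioi (d ^ 2)) :=
    (integrableOn_exp_mul_Ioi hneg _).const_mul _
  have hgm : Measurable g := by
    simp only [hg]
    fun_prop
  have hgi : IntegrableOn g (Set.Ioi (d ^ 2)) := by
    refine Integrable.mono' hfi hgm.aestronglyMeasurable ?_
    refine (ae_restrict_iff' measurableSet_Ioi).2 (Eventually.of_forall fun y hy => ?_)
    rw [Real.norm_of_nonneg (hg0 y hy)]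
    exact hgf y hy
  refine ⟨setIntegral_nonneg measurableSet_Ioi hg0, ?_, ?_⟩
  · calc ∫ y in Set.Ioi (d ^ 2), g y ≤ ∫ y in Set.Ioi (d ^ 2), f y :=
          setIntegral_mono_on hgi hfi measurableSet_Ioi hgf
      _ = (4 * a * x)⁻¹ * Real.exp (-(2 * t)⁻¹ * d ^ 2) := by
          simp only [hf]
          rw [integral_const_mul, integral_exp_mul_Ioi hneg]
          field_simp
      _ ≤ (4 * a * x)⁻¹ * 1 := by
          gcongr
          rw [Real.exp_le_one_iff]
          nlinarith
      _ = _ := mul_one _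
  · have hle : d ^ 2 ≤ t * d ^ 2 := by nlinarith
    set C : ℝ := (2 * t)⁻¹ * Real.exp (-d ^ 2 / 2) / K with hC
    have hinv : ∫ y in Set.Ioc (d ^ 2) (t * d ^ 2), C * y⁻¹ = C * Real.log t := by
      rw [← intervalIntegral.integral_of_le hle, intervalIntegral.integral_const_mul,
        integral_inv_of_pos hm0 (by positivity)]
      congr 2
      field_simp
    have hii : IntegrableOn (fun y : ℝ => C * y⁻¹) (Set.Ioc (d ^ 2) (t * d ^ 2)) := by
      refine IntegrableOn.mono_set ?_ Set.Ioc_subset_Icc_self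
      refine ContinuousOn.integrableOn_Icc ?_
      refine continuousOn_const.mul (continuousOn_id.inv₀ ?_)
      intro y hy
      exact (hm0.trans_le hy.1).ne'
    have key : C * Real.log t ≤ ∫ y in Set.Ioi (d ^ 2), g y := by
      rw [← hinv]
      calc _ ≤ ∫ y in Set.Ioc (d ^ 2) (t * d ^ 2), g y := by
            refine setIntegral_mono_on hii (hgi.mono_set Set.Ioc_subset_Ioi_self)
              measurableSet_Ioc ?_
            intro y hy
            have hy1 : y ∈ Set.Ioi (d ^ 2) := hy.1
            have hy0 : 0 < y := hm0.trans hy.1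
            have h1 := h4.trans_le (hden y hy1)
            have h2 := hden2 y hy1
            have h3 : -d ^ 2 / 2 ≤ -y / (2 * t) := by
              rw [div_le_div_iff₀ (by norm_num) (by positivity)]
              nlinarith [hy.2]
            calc C * y⁻¹ = (2 * t)⁻¹ * Real.exp (-d ^ 2 / 2) / (K * y) := by
                  rw [hC]; field_simp
              _ ≤ g y := by
                  simp only [hg]
                  gcongr
        _ ≤ _ := setIntegral_mono_set hgi
            ((ae_restrict_iff' measurableSet_Ioi).2 (Eventually.of_forall hg0))
            Set.Ioc_subset_Ioi_self.eventuallyLE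
    calc _ = t * (C * Real.log t) := by rw [hC]; field_simp
      _ ≤ _ := by gcongr

/-- Right-tail asymptotic of the first-order perturbed Bessel first passage time density:
p(t) → 0 as t → ∞, while t^{3/2}·p(t) → +∞. -/
theorem stmt_17 (a x ε : ℝ) (ha : 0 < a) (hax : a < x) (hε : 0 < ε)
    (p : ℝ → ℝ)
    (hp : ∀ t : ℝ, 0 < t → p t =
      (1 + (ε / 2) * Real.log (a / x)) *
          ((x - a) * (2 * Real.pi) ^ (-(1 / 2 : ℝ)) * t ^ (-(3 / 2 : ℝ)) *
            Real.exp (-(x - a) ^ 2 / (2 * t))) +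
        ε * (x - a) * (2 * Real.pi * t) ^ (-(1 / 2 : ℝ)) *
          ∫ y in Set.Ioi ((x - a) ^ 2),
            (2 * t)⁻¹ * Real.exp (-y / (2 * t)) /
              ((Real.sqrt y - x + 3 * a) * (Real.sqrt y + x + a))) :
    Tendsto p atTop (nhds 0) ∧
      Tendsto (fun t : ℝ => t ^ ((3 : ℝ) / 2) * p t) atTop atTop := by
  obtain ⟨B, c, hc, H⟩ := aux_integral a x ha hax
  set I : ℝ → ℝ := fun t => ∫ y in Set.Ioi ((x - a) ^ 2),
            (2 * t)⁻¹ * Real.exp (-y / (2 * t)) /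
              ((Real.sqrt y - x + 3 * a) * (Real.sqrt y + x + a)) with hI
  obtain ⟨q, hq⟩ : ∃ q, q = (2 * Real.pi) ^ (-(1 / 2 : ℝ)) := ⟨_, rfl⟩
  have hq0 : 0 < q := by rw [hq]; positivity
  obtain ⟨A, hA⟩ : ∃ A, A = (1 + (ε / 2) * Real.log (a / x)) * ((x - a) * q) := ⟨_, rfl⟩
  obtain ⟨D, hD⟩ : ∃ D, D = ε * (x - a) * q := ⟨_, rfl⟩
  have hxa : 0 < x - a := by linarith
  have hD0 : 0 < D := by rw [hD]; positivity
  have hp' : ∀ t : ℝ, 0 < t → p t = A * Real.exp (-(x - a) ^ 2 / (2 * t)) * t ^ (-(3 / 2 : ℝ)) +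
      D * I t * t ^ (-(1 / 2 : ℝ)) := by
    intro t ht
    rw [hp t ht, Real.mul_rpow (by positivity) ht.le, ← hq, hA, hD]
    ring
  have he : ∀ t : ℝ, 0 < t → |A * Real.exp (-(x - a) ^ 2 / (2 * t))| ≤ |A| := by
    intro t ht
    rw [abs_mul, Real.abs_exp]
    refine mul_le_of_le_one_right (abs_nonneg _) (Real.exp_le_one_iff.2 ?_)
    exact div_nonpos_of_nonpos_of_nonneg (by nlinarith) (by positivity)
  constructor
  · have hlim : Tendsto (fun t : ℝ => |A| * t ^ (-(3 / 2 : ℝ)) + D * B * t ^ (-(1 / 2 : ℝ)))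
        atTop (nhds 0) := by
      have h1 := (tendsto_rpow_neg_atTop (show (0 : ℝ) < 3 / 2 by norm_num)).const_mul |A|
      have h2 := (tendsto_rpow_neg_atTop (show (0 : ℝ) < 1 / 2 by norm_num)).const_mul (D * B)
      simpa using h1.add h2
    refine squeeze_zero_norm' ?_ hlim
    filter_upwards [eventually_ge_atTop 1] with t ht
    have ht0 : 0 < t := by linarith
    obtain ⟨h1, h2, -⟩ := H t ht
    have h1' : 0 ≤ I t := h1
    have h2' : I t ≤ B := h2
    rw [hp' t ht0]
    refine (norm_add_le _ _).trans ?_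
    rw [Real.norm_eq_abs, Real.norm_eq_abs, abs_mul]
    have e1 : |t ^ (-(3 / 2 : ℝ))| = t ^ (-(3 / 2 : ℝ)) := abs_of_pos (by positivity)
    have e2 : |D * I t * t ^ (-(1 / 2 : ℝ))| = D * I t * t ^ (-(1 / 2 : ℝ)) :=
      abs_of_nonneg (by positivity)
    rw [e1, e2]
    have := he t ht0
    gcongr
  · have hlim : Tendsto (fun t : ℝ => -|A| + D * c * Real.log t) atTop atTop :=
      tendsto_atTop_add_const_left _ _
        (Real.tendsto_log_atTop.const_mul_atTop (by positivity))
    refine tendsto_atTop_mono' _ ?_ hlim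
    filter_upwards [eventually_ge_atTop 1] with t ht
    have ht0 : 0 < t := by linarith
    have h3 : c * Real.log t ≤ t * I t := (H t ht).2.2
    have e1 : t ^ ((3 : ℝ) / 2) * t ^ (-(3 / 2 : ℝ)) = 1 := by
      rw [← Real.rpow_add ht0]; norm_num
    have e2 : t ^ ((3 : ℝ) / 2) * t ^ (-(1 / 2 : ℝ)) = t := by
      rw [← Real.rpow_add ht0]; norm_num
    have e3 : t ^ ((3 : ℝ) / 2) * p t = A * Real.exp (-(x - a) ^ 2 / (2 * t)) + D * (t * I t) := by
      rw [hp' t ht0]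
      linear_combination (A * Real.exp (-(x - a) ^ 2 / (2 * t))) * e1 + D * I t * e2
    rw [e3]
    have h5 := (abs_le.1 (he t ht0)).1
    have h6 := mul_le_mul_of_nonneg_left h3 hD0.le
    linarith
end
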